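/- arXiv:2512.05480 — 8 statements merged into one kernel-verified Lean document; each statement's English description precedes it below -/
import Mathlib

section
/- Let n ≥ 3 and let x be an integer with 1 < x < n satisfying n < 2x and 3x ≤ 2n. Then the 5-regular circulant graph G = C_{2n}(x,1,n) is word-representable, and moreover there exists a 5-uniform word representing G; in particular R(G) ≤ 5. -/
/-- Two letters `x` and `y` alternate in the word `w` if, after deleting all letters
other than `x` and `y`, no two consecutive letters of the resulting word are equal. -/
def Alternate {V : Type*} [DecidableEq V] (w : List V) (x y : V) : Prop :=
  (w.filter (fun z => decide (z = x ∨ z = y))).Chain' (· ≠ ·)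

/-- A word `w` represents the graph `G` if it contains every vertex at least once and
two distinct vertices are adjacent in `G` iff they alternate in `w`. -/
def Represents {V : Type*} [DecidableEq V] (G : SimpleGraph V) (w : List V) : Prop :=
  (∀ v : V, v ∈ w) ∧ ∀ x y : V, x ≠ y → (G.Adj x y ↔ Alternate w x y)

/-- A graph is word-representable if some word represents it. -/
def WordRepresentable {V : Type*} [DecidableEq V] (G : SimpleGraph V) : Prop :=
  ∃ w : List V, Represents G w

/-- A word is `k`-uniform if every letter of the alphabet occurs in it exactly `k` times. -/
def IsKUniform {V : Type*} [DecidableEq V] (w : List V) (k : ℕ) : Prop :=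
  ∀ v : V, w.count v = k

/-- Two letters alternate in the word `f 0, …, f (N - 1)` if between any two occurrences of one
there is an occurrence of the other. -/
lemma alternate_map_range {V : Type*} [DecidableEq V] (f : ℕ → V) (u v : V) (N : ℕ)
    (hu : ∀ i j, i < j → j < N → f i = u → f j = u → ∃ r, i < r ∧ r < j ∧ f r = v)
    (hv : ∀ i j, i < j → j < N → f i = v → f j = v → ∃ r, i < r ∧ r < j ∧ f r = u) :
    Alternate ((List.range N).map f) u v := by
  unfold Alternate
  suffices h : ∀ M ≤ N,
      (((List.range M).map f).filter (fun z => decide (z = u ∨ z = v))).IsChain (· ≠ ·) ∧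
      ∀ c ∈ (((List.range M).map f).filter (fun z => decide (z = u ∨ z = v))).getLast?,
        ∃ i < M, f i = c ∧ ∀ r, i < r → r < M → f r ≠ u ∧ f r ≠ v from (h N le_rfl).1
  intro M
  induction M with
  | zero => simp
  | succ M ih =>
    intro hM
    obtain ⟨hc, hl⟩ := ih (by omega)
    rw [List.range_succ, List.map_append, List.filter_append]
    by_cases hfM : f M = u ∨ f M = v
    · have hs : (List.map f [M]).filter (fun z => decide (z = u ∨ z = v)) = [f M] := by
        simp [hfM]
      rw [hs]
      refine ⟨List.isChain_append.2 ⟨hc, by simp, ?_⟩, ?_⟩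
      · intro c hcl y hy hcy
        obtain ⟨i, hi, hic, hr⟩ := hl c hcl
        simp only [List.head?_cons, Option.mem_def, Option.some.injEq] at hy
        subst hy
        rcases hfM with h | h
        · obtain ⟨r, h1, h2, h3⟩ := hu i M hi (by omega) (by rw [hic, hcy, h]) h
          exact (hr r h1 h2).2 h3
        · obtain ⟨r, h1, h2, h3⟩ := hv i M hi (by omega) (by rw [hic, hcy, h]) h
          exact (hr r h1 h2).1 h3
      · intro c hcl
        simp only [List.getLast?_append, List.getLast?_singleton, Option.some_or, Option.mem_def,
          Option.some.injEq] at hcl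
        exact ⟨M, by omega, hcl, fun r h1 h2 => by omega⟩
    · have hs : (List.map f [M]).filter (fun z => decide (z = u ∨ z = v)) = [] := by
        simpa using hfM
      rw [hs, List.append_nil]
      refine ⟨hc, fun c hcl => ?_⟩
      obtain ⟨i, hi, hic, hr⟩ := hl c hcl
      refine ⟨i, by omega, hic, fun r h1 h2 => ?_⟩
      rcases Nat.lt_succ_iff_lt_or_eq.1 h2 with h | rfl
      · exact hr r h1 h
      · exact not_or.1 hfM

/-- Two letters do not alternate in the word `f 0, …, f (N - 1)` if two occurrences of one are not
separated by the other. -/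
lemma not_alternate_map_range {V : Type*} [DecidableEq V] (f : ℕ → V) (u v : V) (N i j : ℕ)
    (hij : i < j) (hj : j < N) (hi : f i = u) (hju : f j = u)
    (hr : ∀ r, i < r → r < j → f r ≠ v) :
    ¬ Alternate ((List.range N).map f) u v := by
  obtain ⟨a, rfl⟩ := Nat.exists_eq_add_of_lt hij
  obtain ⟨b, rfl⟩ := Nat.exists_eq_add_of_lt hj
  have hsplit : List.range (i + a + 1 + b + 1) = List.range' 0 i ++
      (i :: (List.range' (i + 1) a ++ ((i + a + 1) :: List.range' (i + a + 1 + 1) b))) := by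
    rw [List.range_eq_range', show i + a + 1 + b + 1 = i + (a + (b + 1) + 1) by ring,
      ← List.range'_append_1, zero_add, List.range'_succ, ← List.range'_append_1,
      List.range'_succ, show i + 1 + a = i + a + 1 by ring]
  unfold Alternate
  rw [hsplit]
  simp only [List.map_append, List.map_cons, List.filter_append, List.filter_cons, hi, hju,
    true_or, decide_true, if_true]
  intro h
  have h1 := (List.isChain_append.1 h).2.1
  have hB : ∀ c ∈ ((List.range' (i + 1) a).map f).filter (fun z => decide (z = u ∨ z = v)),
      c = u := by
    intro c hc
    simp only [List.mem_filter, List.mem_map, List.mem_range'_1, decide_eq_true_eq] at hc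
    obtain ⟨⟨r, hra, rfl⟩, hcuv⟩ := hc
    exact hcuv.resolve_right (hr r (by omega) (by omega))
  generalize ((List.range' (i + 1) a).map f).filter (fun z => decide (z = u ∨ z = v)) = B at h1 hB
  cases B with
  | nil => simp at h1
  | cons c B =>
    rw [List.cons_append, List.isChain_cons_cons] at h1
    exact h1.1 (hB c (by simp)).symm

/-- A periodic bi-infinite word represents `G` through one of its periods if neighbours separate
each other everywhere and every non-neighbour fails to separate some two nearby occurrences. -/
lemma represents_of_periodic {V : Type*} [DecidableEq V] (G : SimpleGraph V) (f : ℤ → V) (N : ℕ)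
    (hN : 0 < N) (hf : ∀ p k : ℤ, f (p + N * k) = f p)
    (hadj : ∀ u v, G.Adj u v → ∀ p q, p < q → f p = u → f q = u → ∃ r, p < r ∧ r < q ∧ f r = v)
    (hnon : ∀ u, ∃ p q, p < q ∧ f p = u ∧ f q = u ∧
      ∀ r, p < r → r < q → f r ≠ u → G.Adj u (f r)) :
    Represents G ((List.range N).map (fun i => f (i : ℕ))) := by
  have key : ∀ u, ∃ p q : ℤ, 0 ≤ p ∧ p < N ∧ p < q ∧ f p = u ∧ f q = u ∧
      ∀ r, p < r → r < q → f r ≠ u → G.Adj u (f r) := by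
    intro u
    obtain ⟨p, q, hpq, hp, hq, hr⟩ := hnon u
    have hNz : (0 : ℤ) < N := by exact_mod_cast hN
    have hmod := Int.emod_add_mul_ediv p N
    refine ⟨p % N, q + N * (-(p / N)), Int.emod_nonneg _ hNz.ne', Int.emod_lt_of_pos _ hNz,
      by linarith, ?_, by rw [hf, hq], ?_⟩
    · rw [← hf _ (p / N), hmod, hp]
    · intro r h1 h2 h3
      rw [← hf r (p / N)] at h3 ⊢
      exact hr _ (by linarith) (by linarith) h3
  constructor
  · intro u
    obtain ⟨p, q, h0, hpN, -, hp, -⟩ := key u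
    lift p to ℕ using h0
    exact List.mem_map.2 ⟨p, List.mem_range.2 (by exact_mod_cast hpN), hp⟩
  · intro u v huv
    constructor
    · have sep : ∀ u v, G.Adj u v → ∀ i j : ℕ, i < j → j < N → f i = u → f j = u →
          ∃ r : ℕ, i < r ∧ r < j ∧ f r = v := by
        intro u v h i j hij _ hi hj
        obtain ⟨r, h1, h2, h3⟩ := hadj u v h i j (by exact_mod_cast hij) hi hj
        lift r to ℕ using by omega
        exact ⟨r, by exact_mod_cast h1, by exact_mod_cast h2, h3⟩
      exact fun h => alternate_map_range _ u v N (sep u v h) (sep v u h.symm)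
    · intro halt
      by_contra hna
      have fit : ∀ u v, u ≠ v → ¬ G.Adj u v →
          Alternate ((List.range N).map (fun i => f (i : ℕ))) u v →
          ∀ p q : ℤ, 0 ≤ p → p < q → f p = u → f q = u →
          (∀ r, p < r → r < q → f r ≠ u → G.Adj u (f r)) → (N : ℤ) ≤ q := by
        intro u v huv hna halt p q h0 hpq hp hq hr
        by_contra! hqN
        lift p to ℕ using h0
        lift q to ℕ using by omega
        refine not_alternate_map_range (fun i : ℕ => f i) u v N p q (by omega) (by omega) hp hq
          (fun r h1 h2 h3 => hna ?_) halt
        have := hr r (by omega) (by omega) (by rw [h3]; exact huv.symm)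
        rwa [h3] at this
      have halt' : Alternate ((List.range N).map (fun i => f (i : ℕ))) v u := by
        simpa only [Alternate, or_comm] using halt
      obtain ⟨p, q, h0, hpN, hpq, hp, hq, hr⟩ := key u
      obtain ⟨p', q', h0', hpN', hpq', hp', hq', hr'⟩ := key v
      have hqN := fit u v huv hna halt p q h0 hpq hp hq hr
      have hqN' := fit v u huv.symm (fun h => hna h.symm) halt' p' q' h0' hpq' hp' hq' hr'
      rcases lt_trichotomy p p' with h | h | h
      · have := hr p' h (by omega) (by rw [hp']; exact huv.symm)
        exact hna (hp' ▸ this)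
      · exact huv (by rw [← hp, ← hp', h])
      · have := hr' p h (by omega) (by rw [hp]; exact huv)
        exact hna (hp ▸ this).symm

/-- The time shifts of the five occurrences of a letter, one for each place in a block of the
word. -/
def shift (n x c : ℤ) : ℤ :=
  if c = 0 then 0 else if c = 1 then 1 else if c = 2 then x else if c = 3 then n else 2 * n - x

/-- The bi-infinite periodic word whose block at time `t` is
`t, t - 1, t - x, t - n, t - (2 * n - x)`. -/
def letter (n x : ℕ) (p : ℤ) : ZMod (2 * n) :=
  ((p / 5 - shift n x (p % 5) : ℤ) : ZMod (2 * n))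

lemma letter_block (n x : ℕ) (t c : ℤ) (h0 : 0 ≤ c) (h5 : c < 5) :
    letter n x (5 * t + c) = ((t - shift n x c : ℤ) : ZMod (2 * n)) := by
  unfold letter
  rw [show (5 * t + c) / 5 = t by omega, show (5 * t + c) % 5 = c by omega]

lemma letter_eq_of_shift (n x : ℕ) (t c w : ℤ) (h0 : 0 ≤ c) (h5 : c < 5)
    (h : t - shift n x c = w ∨ t - shift n x c = w + 2 * n ∨ t - shift n x c = w - 2 * n) :
    letter n x (5 * t + c) = ((w : ℤ) : ZMod (2 * n)) := by
  rw [letter_block n x t c h0 h5, ZMod.intCast_eq_intCast_iff_dvd_sub]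
  push_cast
  rcases h with h | h | h <;> rw [h]
  · simp
  · exact ⟨-1, by ring⟩
  · exact ⟨1, by ring⟩

lemma letter_add_period (n x : ℕ) (p k : ℤ) : letter n x (p + (10 * n : ℕ) * k) = letter n x p := by
  unfold letter
  have h : p + (10 * n : ℕ) * k = p + 5 * (2 * n * k) := by push_cast; ring
  rw [h, Int.add_mul_ediv_left _ _ (by norm_num), Int.add_mul_emod_self_left,
    ZMod.intCast_eq_intCast_iff_dvd_sub]
  exact ⟨-k, by push_cast; ring⟩

lemma sum_range_ite_natCast_eq (M : ℕ) [NeZero M] (v : ZMod M) :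
    ∑ t ∈ Finset.range M, (if (t : ZMod M) = v then 1 else 0) = 1 := by
  rw [Finset.sum_eq_single v.val]
  · simp
  · intro t ht htv
    rw [if_neg]
    rintro rfl
    exact htv (ZMod.val_cast_of_lt (Finset.mem_range.1 ht)).symm
  · intro h
    exact absurd (Finset.mem_range.2 (ZMod.val_lt v)) h

lemma count_letter (n x : ℕ) (hn : 0 < n) (v : ZMod (2 * n)) :
    ((List.range (10 * n)).map (fun i : ℕ => letter n x i)).count v = 5 := by
  have : NeZero (2 * n) := ⟨by omega⟩
  have blocks : ∀ k : ℕ, ((List.range (5 * k)).map (fun i : ℕ => letter n x i)).count v =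
      ∑ t ∈ Finset.range k, ∑ c ∈ Finset.range 5,
        (if (t : ZMod (2 * n)) = v + (shift n x c : ℤ) then 1 else 0) := by
    intro k
    induction k with
    | zero => simp
    | succ k ih =>
      have hletter : ∀ c : ℕ, c < 5 →
          letter n x ((5 * k + c : ℕ) : ℤ) = (k : ZMod (2 * n)) - (shift n x c : ℤ) := by
        intro c hc
        push_cast
        rw [letter_block n x k c (by omega) (by omega)]
        push_cast
        rfl
      rw [show 5 * (k + 1) = 5 * k + 5 by ring, List.range_add, List.map_append, List.count_append,
        ih, Finset.sum_range_succ]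
      congr 1
      simp only [List.map_map, Finset.sum_range_succ, Finset.sum_range_zero]
      simp only [List.range_succ, List.range_zero, List.nil_append, List.map_append, List.map_cons,
        List.map_nil, List.count_append, Function.comp_apply, hletter _ (show 0 < 5 by norm_num),
        hletter _ (show 1 < 5 by norm_num), hletter _ (show 2 < 5 by norm_num),
        hletter _ (show 3 < 5 by norm_num), hletter _ (show 4 < 5 by norm_num),
        List.count_singleton, beq_iff_eq, sub_eq_iff_eq_add]
      simp
  rw [show 10 * n = 5 * (2 * n) by ring, blocks, Finset.sum_comm]
  simp only [sum_range_ite_natCast_eq]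
  simp

/-- Consecutive occurrences of a letter are separated by each of its neighbours. -/
lemma exists_neighbor_between (n x : ℕ) (hx1 : 1 < x) (hxn : x < n) (h0 : n < 2 * x)
    (h1 : 3 * x ≤ 2 * n) (d : ℤ) (hd : d = 1 ∨ d = -1 ∨ d = x ∨ d = -x ∨ d = n)
    (p q : ℤ) (hpq : p < q) (h : letter n x p = letter n x q) :
    ∃ r, p < r ∧ r < q ∧ letter n x r = letter n x p + (d : ZMod (2 * n)) := by
  obtain ⟨t, c, hc0, hc5, rfl⟩ : ∃ t c : ℤ, 0 ≤ c ∧ c < 5 ∧ p = 5 * t + c :=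
    ⟨p / 5, p % 5, by omega, by omega, by omega⟩
  obtain ⟨t', c', hc0', hc5', rfl⟩ : ∃ t c : ℤ, 0 ≤ c ∧ c < 5 ∧ q = 5 * t + c :=
    ⟨q / 5, q % 5, by omega, by omega, by omega⟩
  rw [letter_block n x t c hc0 hc5, letter_block n x t' c' hc0' hc5',
    ZMod.intCast_eq_intCast_iff_dvd_sub] at h
  obtain ⟨k, hk⟩ := h
  have hK : t' - shift n x c' - (t - shift n x c) ≤ -(2 * n) ∨
      t' - shift n x c' - (t - shift n x c) = 0 ∨ 2 * n ≤ t' - shift n x c' - (t - shift n x c) := by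
    rw [hk]
    push_cast
    rcases lt_trichotomy k 0 with hk0 | rfl | hk0
    · left; nlinarith
    · simp
    · right; right; nlinarith
  clear hk
  -- a lower bound for the distance to the next occurrence
  have hgap : 5 * t + c + (if c = 0 then 6 else if c = 1 then 5 * (x : ℤ) - 4 else
      if c = 2 ∨ c = 3 then 5 * ((n : ℤ) - x) + 1 else 5 * (x : ℤ) - 4) ≤ 5 * t' + c' := by
    unfold shift at hK
    split_ifs at hK ⊢ <;> omega
  clear hK
  rw [letter_block n x t c hc0 hc5, ← Int.cast_add]
  have goal : ∀ t₁ c₁ s₁ : ℤ, shift n x c₁ = s₁ →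
      (0 ≤ c₁ ∧ c₁ < 5 ∧ 5 * t + c < 5 * t₁ + c₁ ∧ 5 * t₁ + c₁ < 5 * t' + c' ∧
        (t₁ - s₁ = t - shift n x c + d ∨ t₁ - s₁ = t - shift n x c + d + 2 * n ∨
          t₁ - s₁ = t - shift n x c + d - 2 * n)) →
      ∃ r, 5 * t + c < r ∧ r < 5 * t' + c' ∧
        letter n x r = ((t - shift n x c + d : ℤ) : ZMod (2 * n)) := by
    rintro t₁ c₁ _ rfl ⟨ha, hb, hlt, hgt, hs⟩
    exact ⟨5 * t₁ + c₁, hlt, hgt, letter_eq_of_shift n x t₁ c₁ _ ha hb hs⟩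
  obtain rfl | rfl | rfl | rfl | rfl : c = 0 ∨ c = 1 ∨ c = 2 ∨ c = 3 ∨ c = 4 := by omega
  all_goals norm_num at hgap
  · rw [show shift n x 0 = 0 from rfl] at goal ⊢
    rcases hd with rfl | rfl | rfl | rfl | rfl
    · exact goal (t + 1) 0 0 rfl (by omega)
    · exact goal t 1 1 rfl (by omega)
    · exact goal t 4 (2 * n - x) rfl (by omega)
    · exact goal t 2 x rfl (by omega)
    · exact goal t 3 n rfl (by omega)
  · rw [show shift n x 1 = 1 from rfl] at goal ⊢
    rcases hd with rfl | rfl | rfl | rfl | rfl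
    · exact goal (t + 1) 1 1 rfl (by omega)
    · exact goal (t - 2 + x) 2 x rfl (by omega)
    · exact goal (t - 1 + x) 0 0 rfl (by omega)
    · exact goal (t - 1 + n - x) 3 n rfl (by omega)
    · exact goal (t - 1 + n - x) 4 (2 * n - x) rfl (by omega)
  · rw [show shift n x 2 = x from rfl] at goal ⊢
    rcases hd with rfl | rfl | rfl | rfl | rfl
    · exact goal (t + 1) 2 x rfl (by omega)
    · exact goal (t - x - 1 + n) 3 n rfl (by omega)
    · exact goal (t + 1) 1 1 rfl (by omega)
    · exact goal (t - 3 * x + 2 * n) 4 (2 * n - x) rfl (by omega)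
    · exact goal (t - x + n) 0 0 rfl (by omega)
  · rw [show shift n x 3 = n from rfl] at goal ⊢
    rcases hd with rfl | rfl | rfl | rfl | rfl
    · exact goal (t + 1) 3 n rfl (by omega)
    · exact goal (t - 1 + n - x) 4 (2 * n - x) rfl (by omega)
    · exact goal (t - n + 2 * x) 2 x rfl (by omega)
    · exact goal (t + n - x) 0 0 rfl (by omega)
    · exact goal (t + 1) 1 1 rfl (by omega)
  · rw [show shift n x 4 = (2 * n - x) from rfl] at goal ⊢
    rcases hd with rfl | rfl | rfl | rfl | rfl
    · exact goal (t + 1) 4 (2 * n - x) rfl (by omega)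
    · exact goal (t + x - 1) 0 0 rfl (by omega)
    · exact goal (t + 2 * x - n) 3 n rfl (by omega)
    · exact goal (t + 1) 1 1 rfl (by omega)
    · exact goal (t - n + 2 * x) 2 x rfl (by omega)

theorem stmt11 (n x : ℕ) (hn : 3 ≤ n) (hx1 : 1 < x) (hxn : x < n)
    (h0 : n < 2*x) (h1 : 3*x ≤ 2*n) :
    WordRepresentable (SimpleGraph.circulantGraph {((1 : ℕ) : ZMod (2*n)), ((x : ℕ) : ZMod (2*n)), ((n : ℕ) : ZMod (2*n))}) ∧
      ∃ w : List (ZMod (2*n)), Represents (SimpleGraph.circulantGraph {((1 : ℕ) : ZMod (2*n)), ((x : ℕ) : ZMod (2*n)), ((n : ℕ) : ZMod (2*n))}) w ∧ IsKUniform w 5 := by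
  have h2n : (2 : ZMod (2 * n)) * n = 0 := by exact_mod_cast ZMod.natCast_self (2 * n)
  suffices h : Represents (SimpleGraph.circulantGraph {((1 : ℕ) : ZMod (2*n)),
      ((x : ℕ) : ZMod (2*n)), ((n : ℕ) : ZMod (2*n))})
      ((List.range (10 * n)).map (fun i : ℕ => letter n x i)) from
    ⟨⟨_, h⟩, _, h, count_letter n x (by omega)⟩
  refine represents_of_periodic _ _ _ (by omega) (letter_add_period n x) ?_ ?_
  · intro u v huv p q hpq hp hq
    obtain ⟨d, hd, hdv⟩ : ∃ d : ℤ, (d = 1 ∨ d = -1 ∨ d = x ∨ d = -x ∨ d = n) ∧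
        v = u + (d : ZMod (2 * n)) := by
      simp only [SimpleGraph.circulantGraph, SimpleGraph.fromRel_adj, Set.mem_insert_iff,
        Set.mem_singleton_iff, Nat.cast_one] at huv
      obtain ⟨-, (h | h | h) | (h | h | h)⟩ := huv
      · exact ⟨-1, by simp, by push_cast; linear_combination -h⟩
      · exact ⟨-x, by simp, by push_cast; linear_combination -h⟩
      · exact ⟨n, by simp, by push_cast; linear_combination -h - h2n⟩
      · exact ⟨1, by simp, by push_cast; linear_combination h⟩
      · exact ⟨x, by simp, by push_cast; linear_combination h⟩
      · exact ⟨n, by simp, by push_cast; linear_combination h⟩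
    obtain ⟨r, hr1, hr2, hr⟩ := exists_neighbor_between n x hx1 hxn h0 h1 d hd p q hpq
      (hp.trans hq.symm)
    exact ⟨r, hr1, hr2, by rw [hr, hp, hdv]⟩
  · intro u
    obtain ⟨a, rfl⟩ := ZMod.intCast_surjective u
    refine ⟨5 * a + 0, 5 * (a + 1) + 1, by omega, ?_, ?_, ?_⟩
    · exact letter_eq_of_shift n x a 0 a (by omega) (by omega) (by simp [shift])
    · exact letter_eq_of_shift n x (a + 1) 1 a (by omega) (by omega) (by simp [shift])
    · intro r hr1 hr2 hne
      simp only [SimpleGraph.circulantGraph, SimpleGraph.fromRel_adj, Set.mem_insert_iff,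
        Set.mem_singleton_iff, Nat.cast_one]
      refine ⟨hne.symm, ?_⟩
      obtain rfl | rfl | rfl | rfl | rfl : r = 5 * a + 1 ∨ r = 5 * a + 2 ∨ r = 5 * a + 3 ∨
          r = 5 * a + 4 ∨ r = 5 * (a + 1) + 0 := by omega
      all_goals
        rw [letter_block n x _ _ (by omega) (by omega)]
        simp [shift, h2n]
end

section
/- Let x ≥ 2 be an integer and let n = 2x (so n ≥ 4 is even and x = n/2). Then the 5-regular circulant graph G = C_{2n}(x,1,n) is word-representable, and moreover there exists a 5-uniform word representing G; in particular R(G) ≤ 5. -/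
/-- In a strictly increasing list, being a chain for `R` is a condition on the pairs of elements
with no element in between. -/
theorem List.isChain_iff_of_pairwise_lt {R : ℕ → ℕ → Prop} {l : List ℕ}
    (hl : l.Pairwise (· < ·)) :
    l.IsChain R ↔ ∀ s ∈ l, ∀ t ∈ l, s < t → (∀ r ∈ l, ¬ (s < r ∧ r < t)) → R s t := by
  induction l with
  | nil => simp
  | cons a l ih =>
    obtain ⟨ha, htail⟩ := List.pairwise_cons.1 hl
    rw [List.isChain_cons, ih htail]
    constructor
    · rintro ⟨hhead, hrec⟩ s hs t ht hst hgap
      rcases List.mem_cons.1 ht with rfl | htl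
      · rcases List.mem_cons.1 hs with rfl | hs
        · omega
        · have := ha s hs
          omega
      · rcases List.mem_cons.1 hs with rfl | hs
        · cases l with
          | nil => simp at htl
          | cons b l =>
            have hb := ha b (by simp)
            rcases List.mem_cons.1 htl with rfl | htl
            · exact hhead _ (by simp)
            · exact absurd ⟨hb, (List.pairwise_cons.1 htail).1 t htl⟩ (hgap b (by simp))
        · exact hrec s hs t htl hst fun r hr => hgap r (List.mem_cons_of_mem _ hr)
    · intro h
      refine ⟨fun b hb => ?_, fun s hs t ht hst hgap => ?_⟩
      · cases l with
        | nil => simp at hb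
        | cons c l =>
          obtain rfl : c = b := by simpa using hb
          refine h a (by simp) c (by simp) (ha c (by simp)) fun r hr hr' => ?_
          rcases List.mem_cons.1 hr with rfl | hr
          · omega
          · rcases List.mem_cons.1 hr with rfl | hr
            · omega
            · have := (List.pairwise_cons.1 htail).1 r hr
              omega
      · refine h s (List.mem_cons_of_mem _ hs) t (List.mem_cons_of_mem _ ht) hst fun r hr hr' => ?_
        rcases List.mem_cons.1 hr with rfl | hr
        · have := ha s hs
          omega
        · exact hgap r hr hr'

/-- `p 0 < p 1 < ⋯ < p (k - 1)` are the positions below `N` at which `f` takes the value `a`. -/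
structure Occurrences {V : Type*} (f : ℕ → V) (N : ℕ) (a : V) (k : ℕ) (p : ℕ → ℕ) : Prop where
  lt : ∀ i j, i < j → j < k → p i < p j
  iff : ∀ t, (t < N ∧ f t = a) ↔ ∃ i < k, t = p i

/-- The first `k` terms of `p` and `q` satisfy `p 0 < q 0 < p 1 < q 1 < ⋯`. -/
def Ladder (k : ℕ) (p q : ℕ → ℕ) : Prop :=
  (∀ i < k, p i < q i) ∧ ∀ i, i + 1 < k → q i < p (i + 1)

theorem alternate_map_range_iff {V : Type*} [DecidableEq V] (f : ℕ → V) (N : ℕ) (a b : V) :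
    Alternate ((List.range N).map f) a b ↔
      ∀ s t, s < t → t < N → (f s = a ∨ f s = b) → f s = f t →
        ∃ r, s < r ∧ r < t ∧ (f r = a ∨ f r = b) := by
  have hsorted : ((List.range N).filter
      ((fun z => decide (z = a ∨ z = b)) ∘ f)).Pairwise (· < ·) :=
    List.pairwise_lt_range.filter _
  change List.IsChain _ _ ↔ _
  rw [List.filter_map, List.isChain_map, List.isChain_iff_of_pairwise_lt hsorted]
  simp only [List.mem_filter, List.mem_range, Function.comp, decide_eq_true_eq]
  constructor
  · intro h s t hst ht hs heq
    by_contra! hno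
    refine h s ⟨by omega, hs⟩ t ⟨ht, heq ▸ hs⟩ hst (fun r hr hr' => ?_) heq
    have := hno r hr'.1 hr'.2
    tauto
  · intro h s hs t ht hst hgap heq
    obtain ⟨r, hsr, hrt, hr⟩ := h s t hst ht.1 hs.2 heq
    exact hgap r ⟨by omega, hr⟩ ⟨hsr, hrt⟩

theorem Alternate.symm {V : Type*} [DecidableEq V] {w : List V} {a b : V}
    (h : Alternate w a b) : Alternate w b a := by
  unfold Alternate at *
  simpa only [or_comm] using h

section

variable {V : Type*} {f : ℕ → V} {N k : ℕ} {a b : V} {p q : ℕ → ℕ}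

theorem Occurrences.le (hp : Occurrences f N a k p) {i j : ℕ} (hij : i ≤ j) (hj : j < k) :
    p i ≤ p j := by
  rcases hij.eq_or_lt with rfl | h
  · rfl
  · exact (hp.lt i j h hj).le

theorem Occurrences.index_lt (hp : Occurrences f N a k p) {i j : ℕ} (hi : i < k)
    (h : p i < p j) : i < j := by
  by_contra! hji
  have := hp.le hji hi
  omega

theorem Occurrences.exists_between [DecidableEq V] (hp : Occurrences f N a k p) (hq : Occurrences f N b k q)
    (h : Alternate ((List.range N).map f) a b) {i : ℕ} (hi : i + 1 < k) :
    ∃ j < k, p i < q j ∧ q j < p (i + 1) := by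
  rw [alternate_map_range_iff] at h
  have hs := (hp.iff (p i)).2 ⟨i, by omega, rfl⟩
  have ht := (hp.iff (p (i + 1))).2 ⟨i + 1, hi, rfl⟩
  obtain ⟨r, hsr, hrt, hr⟩ := h _ _ (hp.lt i (i + 1) (by omega) hi) ht.1 (Or.inl hs.2)
    (hs.2.trans ht.2.symm)
  rcases hr with hr | hr
  · obtain ⟨j, hj, rfl⟩ := (hp.iff r).1 ⟨by omega, hr⟩
    have h₁ := hp.index_lt (by omega) hsr
    have h₂ := hp.index_lt hj hrt
    omega
  · obtain ⟨j, hj, rfl⟩ := (hq.iff r).1 ⟨by omega, hr⟩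
    exact ⟨j, hj, hsr, hrt⟩

theorem Occurrences.ladder [DecidableEq V] (hp : Occurrences f N a k p) (hq : Occurrences f N b k q)
    (h : Alternate ((List.range N).map f) a b) (h0 : p 0 < q 0) : Ladder k p q := by
  have step : ∀ i < k, p i < q i ∧ (i + 1 < k → q i < p (i + 1)) := by
    intro i
    induction i with
    | zero =>
      refine fun _ => ⟨h0, fun hi => ?_⟩
      obtain ⟨j, hj, -, h₂⟩ := hp.exists_between hq h hi
      exact (hq.le (Nat.zero_le j) hj).trans_lt h₂
    | succ i ih =>
      intro hi
      obtain ⟨hpq, hqp⟩ := ih (by omega)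
      obtain ⟨j, hj, h₁, h₂⟩ := hq.exists_between hp h.symm hi
      have hij := hp.index_lt (by omega) (hpq.trans h₁)
      refine ⟨(hp.le hij hj).trans_lt h₂, fun hi' => ?_⟩
      obtain ⟨l, hl, h₃, h₄⟩ := hp.exists_between hq h hi'
      have hil := hq.index_lt (by omega) ((hqp hi).trans h₃)
      exact (hq.le hil hl).trans_lt h₄
  exact ⟨fun i hi => (step i hi).1, fun i hi => (step i (by omega)).2 hi⟩

theorem Ladder.alternate [DecidableEq V] (hp : Occurrences f N a k p)
    (hq : Occurrences f N b k q) (h : Ladder k p q) :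
    Alternate ((List.range N).map f) a b := by
  rw [alternate_map_range_iff]
  rintro s t hst ht hs heq
  rcases hs with hs | hs
  · obtain ⟨i, hi, rfl⟩ := (hp.iff s).1 ⟨by omega, hs⟩
    obtain ⟨j, hj, rfl⟩ := (hp.iff t).1 ⟨ht, heq ▸ hs⟩
    have hij := hp.index_lt hi hst
    refine ⟨q i, h.1 i hi, ?_, Or.inr ((hq.iff (q i)).2 ⟨i, hi, rfl⟩).2⟩
    exact (h.2 i (by omega)).trans_le (hp.le hij hj)
  · obtain ⟨i, hi, rfl⟩ := (hq.iff s).1 ⟨by omega, hs⟩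
    obtain ⟨j, hj, rfl⟩ := (hq.iff t).1 ⟨ht, heq ▸ hs⟩
    have hij := hq.index_lt hi hst
    refine ⟨p (i + 1), h.2 i (by omega), ?_,
      Or.inl ((hp.iff (p (i + 1))).2 ⟨i + 1, by omega, rfl⟩).2⟩
    exact (h.1 (i + 1) (by omega)).trans_le (hq.le hij hj)

/-- Two letters with the same positive number of occurrences alternate iff their positions
interlace. -/
theorem alternate_iff_ladder [DecidableEq V] (hk : 0 < k) (hab : a ≠ b)
    (hp : Occurrences f N a k p) (hq : Occurrences f N b k q) :
    Alternate ((List.range N).map f) a b ↔ Ladder k p q ∨ Ladder k q p := by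
  constructor
  · intro h
    rcases lt_trichotomy (p 0) (q 0) with h0 | h0 | h0
    · exact Or.inl (hp.ladder hq h h0)
    · have ha := ((hp.iff (p 0)).2 ⟨0, hk, rfl⟩).2
      have hb := ((hq.iff (q 0)).2 ⟨0, hk, rfl⟩).2
      exact absurd (ha.symm.trans (h0 ▸ hb)) hab
    · exact Or.inr (hq.ladder hp h.symm h0)
  · rintro (h | h)
    · exact h.alternate hp hq
    · exact (h.alternate hq hp).symm

theorem Occurrences.count_eq [DecidableEq V] (hp : Occurrences f N a k p) :
    ((List.range N).map f).count a = k := by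
  have hperm : ((List.range N).filter fun t => f t = a).Perm ((List.range k).map p) := by
    refine (List.perm_ext_iff_of_nodup (List.nodup_range.filter _) ?_).2 fun t => ?_
    · refine List.nodup_range.map_on fun i hi j hj hij => ?_
      rw [List.mem_range] at hi hj
      by_contra hne
      rcases lt_or_gt_of_ne hne with h | h
      · exact (hp.lt i j h hj).ne hij
      · exact (hp.lt j i h hi).ne hij.symm
    · have := hp.iff t
      simp only [List.mem_filter, List.mem_range, decide_eq_true_eq, List.mem_map, this]
      exact exists_congr fun i => and_congr_right fun _ => eq_comm
  rw [List.count, List.countP_map, List.countP_eq_length_filter]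
  simpa [Function.comp_def, beq_eq_decide] using hperm.length_eq

end

/-- The jump from the index of a block of five letters to the letter at place `r` of the block,
as a natural number modulo `4 * x`. -/
def blockJump (x r : ℕ) : ℕ :=
  if r = 0 then 0 else if r = 1 then 4 * x - 1 else if r = 2 then x
  else if r = 3 then 2 * x else 3 * x

/-- The letter at position `t` of the word made of the blocks
`v, v - 1, v + x, v + 2 * x, v + 3 * x` for `v = 0, 1, …, 4 * x - 1`. -/
def blockLetter (x t : ℕ) : ZMod (2 * (2 * x)) :=
  ((t / 5 + blockJump x (t % 5) : ℕ) : ZMod (2 * (2 * x)))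

theorem natCast_zmod_eq_iff {x s v : ℕ} (hs : s < 8 * x) (hv : v < 4 * x) :
    ((s : ℕ) : ZMod (2 * (2 * x))) = (v : ℕ) ↔ s = v ∨ s = v + 4 * x := by
  rw [ZMod.natCast_eq_natCast_iff', Nat.mod_eq_of_lt (show v < 2 * (2 * x) by omega)]
  rcases lt_or_ge s (2 * (2 * x)) with h | h
  · rw [Nat.mod_eq_of_lt h]
    omega
  · rw [Nat.mod_eq_sub_mod h, Nat.mod_eq_of_lt (by omega)]
    omega

theorem blockLetter_eq_iff {x t v : ℕ} (ht : t < 20 * x) (hv : v < 4 * x) :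
    blockLetter x t = (v : ℕ) ↔
      t / 5 + blockJump x (t % 5) = v ∨ t / 5 + blockJump x (t % 5) = v + 4 * x := by
  refine natCast_zmod_eq_iff ?_ hv
  unfold blockJump
  split_ifs <;> omega

/-- The positions of the letter `v` in the word with letters `blockLetter x`. -/
def BlockPositions (x v p₀ p₁ p₂ p₃ p₄ : ℕ) : Prop :=
  (v < x ∧ p₀ = 5 * v ∧ p₁ = 5 * v + 6 ∧ p₂ = 5 * (v + x) + 4 ∧ p₃ = 5 * (v + 2 * x) + 3 ∧
    p₄ = 5 * (v + 3 * x) + 2) ∨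
  (x ≤ v ∧ v < 2 * x ∧ p₀ + 5 * x = 5 * v + 2 ∧ p₁ = 5 * v ∧ p₂ = 5 * v + 6 ∧
    p₃ = 5 * (v + x) + 4 ∧ p₄ = 5 * (v + 2 * x) + 3) ∨
  (2 * x ≤ v ∧ v < 3 * x ∧ p₀ + 10 * x = 5 * v + 3 ∧ p₁ + 5 * x = 5 * v + 2 ∧ p₂ = 5 * v ∧
    p₃ = 5 * v + 6 ∧ p₄ = 5 * (v + x) + 4) ∨
  (3 * x ≤ v ∧ v + 1 < 4 * x ∧ p₀ + 15 * x = 5 * v + 4 ∧ p₁ + 10 * x = 5 * v + 3 ∧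
    p₂ + 5 * x = 5 * v + 2 ∧ p₃ = 5 * v ∧ p₄ = 5 * v + 6) ∨
  (v + 1 = 4 * x ∧ p₀ = 1 ∧ p₁ + 15 * x = 5 * v + 4 ∧ p₂ + 10 * x = 5 * v + 3 ∧
    p₃ + 5 * x = 5 * v + 2 ∧ p₄ = 5 * v)

theorem exists_blockPositions {x v : ℕ} (hv : v < 4 * x) :
    ∃ p₀ p₁ p₂ p₃ p₄, BlockPositions x v p₀ p₁ p₂ p₃ p₄ := by
  unfold BlockPositions
  rcases lt_or_ge v x with h | h
  · exact ⟨_, _, _, _, _, Or.inl ⟨h, rfl, rfl, rfl, rfl, rfl⟩⟩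
  rcases lt_or_ge v (2 * x) with h | h
  · exact ⟨5 * v + 2 - 5 * x, 5 * v, 5 * v + 6, 5 * (v + x) + 4, 5 * (v + 2 * x) + 3, by omega⟩
  rcases lt_or_ge v (3 * x) with h | h
  · exact ⟨5 * v + 3 - 10 * x, 5 * v + 2 - 5 * x, 5 * v, 5 * v + 6, 5 * (v + x) + 4, by omega⟩
  rcases lt_or_ge (v + 1) (4 * x) with h | h
  · exact ⟨5 * v + 4 - 15 * x, 5 * v + 3 - 10 * x, 5 * v + 2 - 5 * x, 5 * v, 5 * v + 6, by omega⟩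
  · exact ⟨1, 5 * v + 4 - 15 * x, 5 * v + 3 - 10 * x, 5 * v + 2 - 5 * x, 5 * v, by omega⟩

theorem BlockPositions.occurrences {x v p₀ p₁ p₂ p₃ p₄ : ℕ} (hx : 2 ≤ x) (hv : v < 4 * x)
    (h : BlockPositions x v p₀ p₁ p₂ p₃ p₄) :
    Occurrences (blockLetter x) (20 * x) (v : ZMod (2 * (2 * x))) 5
      (fun i => [p₀, p₁, p₂, p₃, p₄].getD i 0) := by
  have hlt : p₀ < p₁ ∧ p₁ < p₂ ∧ p₂ < p₃ ∧ p₃ < p₄ ∧ p₄ < 20 * x := by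
    unfold BlockPositions at h
    omega
  refine ⟨fun i j hij hj => ?_, fun t => ?_⟩
  · interval_cases j <;> interval_cases i <;> simp <;> omega
  · have hexists : (∃ i < 5, t = [p₀, p₁, p₂, p₃, p₄].getD i 0) ↔
        t = p₀ ∨ t = p₁ ∨ t = p₂ ∨ t = p₃ ∨ t = p₄ := by
      constructor
      · rintro ⟨i, hi, rfl⟩
        interval_cases i <;> simp
      · rintro (h | h | h | h | h)
        · exact ⟨0, by omega, h⟩
        · exact ⟨1, by omega, h⟩
        · exact ⟨2, by omega, h⟩
        · exact ⟨3, by omega, h⟩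
        · exact ⟨4, by omega, h⟩
    rw [hexists]
    rcases lt_or_ge t (20 * x) with ht | ht
    · rw [blockLetter_eq_iff ht hv]
      unfold blockJump
      obtain ⟨b, r, hr, rfl⟩ : ∃ b r, r < 5 ∧ t = 5 * b + r :=
        ⟨t / 5, t % 5, by omega, by omega⟩
      have h₁ : (5 * b + r) / 5 = b := by omega
      have h₂ : (5 * b + r) % 5 = r := by omega
      rw [h₁, h₂]
      unfold BlockPositions at h
      rcases h with h | h | h | h | h <;> interval_cases r <;> simp <;> omega
    · omega

theorem ladder_five_iff (p₀ p₁ p₂ p₃ p₄ q₀ q₁ q₂ q₃ q₄ : ℕ) :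
    Ladder 5 (fun i => [p₀, p₁, p₂, p₃, p₄].getD i 0) (fun i => [q₀, q₁, q₂, q₃, q₄].getD i 0) ↔
      p₀ < q₀ ∧ q₀ < p₁ ∧ p₁ < q₁ ∧ q₁ < p₂ ∧ p₂ < q₂ ∧ q₂ < p₃ ∧ p₃ < q₃ ∧ q₃ < p₄ ∧
        p₄ < q₄ := by
  constructor
  · rintro ⟨h, h'⟩
    exact ⟨h 0 (by simp), h' 0 (by simp), h 1 (by simp), h' 1 (by simp), h 2 (by simp),
      h' 2 (by simp), h 3 (by simp), h' 3 (by simp), h 4 (by simp)⟩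
  · rintro ⟨h₀, h₁, h₂, h₃, h₄, h₅, h₆, h₇, h₈⟩
    constructor
    · intro i hi
      interval_cases i <;> assumption
    · intro i hi
      have hi : i < 4 := by omega
      interval_cases i <;> assumption

theorem BlockPositions.interlace_iff {x u v p₀ p₁ p₂ p₃ p₄ q₀ q₁ q₂ q₃ q₄ : ℕ} (hx : 2 ≤ x)
    (huv : u < v) (hp : BlockPositions x u p₀ p₁ p₂ p₃ p₄)
    (hq : BlockPositions x v q₀ q₁ q₂ q₃ q₄) :
    ((p₀ < q₀ ∧ q₀ < p₁ ∧ p₁ < q₁ ∧ q₁ < p₂ ∧ p₂ < q₂ ∧ q₂ < p₃ ∧ p₃ < q₃ ∧ q₃ < p₄ ∧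
        p₄ < q₄) ∨
      (q₀ < p₀ ∧ p₀ < q₁ ∧ q₁ < p₁ ∧ p₁ < q₂ ∧ q₂ < p₂ ∧ p₂ < q₃ ∧ q₃ < p₃ ∧ p₃ < q₄ ∧
        q₄ < p₄)) ↔
      v = u + 1 ∨ v = u + x ∨ v = u + 2 * x ∨ v = u + 3 * x ∨ v + 1 = u + 4 * x := by
  unfold BlockPositions at hp hq
  rcases hp with hp | hp | hp | hp | hp <;> rcases hq with hq | hq | hq | hq | hq <;> omega

theorem circulantGraph_adj_natCast_iff {x u v : ℕ} (hx : 2 ≤ x) (huv : u < v)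
    (hv : v < 4 * x) :
    (SimpleGraph.circulantGraph {((1 : ℕ) : ZMod (2 * (2 * x))), ((x : ℕ) : ZMod (2 * (2 * x))),
      ((2 * x : ℕ) : ZMod (2 * (2 * x)))}).Adj (u : ZMod (2 * (2 * x))) (v : ZMod (2 * (2 * x))) ↔
      v = u + 1 ∨ v = u + x ∨ v = u + 2 * x ∨ v = u + 3 * x ∨ v + 1 = u + 4 * x := by
  have hne : (u : ZMod (2 * (2 * x))) ≠ v := by
    rw [Ne, natCast_zmod_eq_iff (by omega) hv]
    omega
  have key : ∀ s t c : ℕ, s < 4 * x → t < 4 * x → c < 4 * x →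
      ((s : ZMod (2 * (2 * x))) - t = (c : ℕ) ↔ c + t = s ∨ c + t = s + 4 * x) := by
    intro s t c hs ht hc
    rw [sub_eq_iff_eq_add, eq_comm, ← Nat.cast_add, natCast_zmod_eq_iff (by omega) hs]
  rw [SimpleGraph.circulantGraph_adj, and_iff_right hne]
  simp only [Set.mem_insert_iff, Set.mem_singleton_iff]
  rw [key u v 1, key u v x, key u v (2 * x), key v u 1, key v u x, key v u (2 * x)]
  all_goals omega

theorem represents_blockLetter {x : ℕ} (hx : 2 ≤ x) :
    Represents (SimpleGraph.circulantGraph {((1 : ℕ) : ZMod (2 * (2 * x))),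
      ((x : ℕ) : ZMod (2 * (2 * x))), ((2 * x : ℕ) : ZMod (2 * (2 * x)))})
      ((List.range (20 * x)).map (blockLetter x)) ∧
    IsKUniform ((List.range (20 * x)).map (blockLetter x)) 5 := by
  have : NeZero (2 * (2 * x)) := ⟨by omega⟩
  have hrep : ∀ a : ZMod (2 * (2 * x)), ∃ v : ℕ, v < 4 * x ∧ (v : ZMod (2 * (2 * x))) = a :=
    fun a => ⟨a.val, by have := a.val_lt; omega, ZMod.natCast_zmod_val a⟩
  have hcount : IsKUniform ((List.range (20 * x)).map (blockLetter x)) 5 := by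
    intro a
    obtain ⟨v, hv, rfl⟩ := hrep a
    obtain ⟨p₀, p₁, p₂, p₃, p₄, hp⟩ := exists_blockPositions hv
    exact (hp.occurrences hx hv).count_eq
  have hlt : ∀ u v : ℕ, u < v → v < 4 * x →
      ((SimpleGraph.circulantGraph {((1 : ℕ) : ZMod (2 * (2 * x))),
        ((x : ℕ) : ZMod (2 * (2 * x))), ((2 * x : ℕ) : ZMod (2 * (2 * x)))}).Adj
          (u : ZMod (2 * (2 * x))) (v : ZMod (2 * (2 * x))) ↔
        Alternate ((List.range (20 * x)).map (blockLetter x)) (u : ZMod (2 * (2 * x))) v) := by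
    intro u v huv hv
    have hne : (u : ZMod (2 * (2 * x))) ≠ v := by
      rw [Ne, natCast_zmod_eq_iff (by omega) hv]
      omega
    obtain ⟨p₀, p₁, p₂, p₃, p₄, hp⟩ := exists_blockPositions (huv.trans hv)
    obtain ⟨q₀, q₁, q₂, q₃, q₄, hq⟩ := exists_blockPositions hv
    rw [circulantGraph_adj_natCast_iff hx huv hv, ← hp.interlace_iff hx huv hq,
      alternate_iff_ladder (by omega) hne (hp.occurrences hx (huv.trans hv))
        (hq.occurrences hx hv), ladder_five_iff, ladder_five_iff]
  refine ⟨⟨fun a => ?_, fun a b hab => ?_⟩, hcount⟩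
  · rw [← List.count_pos_iff, hcount a]
    omega
  · obtain ⟨u, hu, rfl⟩ := hrep a
    obtain ⟨v, hv, rfl⟩ := hrep b
    rcases lt_trichotomy u v with h | rfl | h
    · exact hlt u v h hv
    · exact absurd rfl hab
    · rw [SimpleGraph.adj_comm, hlt v u h hu]
      exact ⟨Alternate.symm, Alternate.symm⟩

theorem stmt12 (x n : ℕ) (hx : 2 ≤ x) (hn : n = 2*x) :
    WordRepresentable (SimpleGraph.circulantGraph {((1 : ℕ) : ZMod (2*n)), ((x : ℕ) : ZMod (2*n)), ((n : ℕ) : ZMod (2*n))}) ∧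
      ∃ w : List (ZMod (2*n)), Represents (SimpleGraph.circulantGraph {((1 : ℕ) : ZMod (2*n)), ((x : ℕ) : ZMod (2*n)), ((n : ℕ) : ZMod (2*n))}) w ∧ IsKUniform w 5 := by
  subst hn
  obtain ⟨hrep, huniform⟩ := represents_blockLetter hx
  exact ⟨⟨_, hrep⟩, _, hrep, huniform⟩
end

section
/- Let n ≥ 3 and let x be an integer with 1 < x < n satisfying n ≤ 2x and 3x ≤ 2n. Then the 5-regular circulant graph G = C_{2n}(x,1,n) is word-representable and there exists a 5-uniform word representing G; in particular R(G) ≤ 5. -/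
namespace CirculantWord

/-- The offset of the letter standing at place `s` of a block of five letters. -/
def offset (n x e s : ℤ) : ℤ :=
  if s = 1 then -1 else if s = 3 - e then -x else if s = 3 then -n else if s = 3 + e then x else 0

/-- An integer representing the letter at position `z`: the block with number `j` of the
word is `j, j - 1, j - x, j - n, j + x` if `e = 1` and `j, j - 1, j + x, j - n, j - x` if
`e = -1`. -/
def index (n x e z : ℤ) : ℤ := z / 5 + offset n x e (z % 5)

theorem index_cases (n x z : ℤ) {e : ℤ} (he : e = 1 ∨ e = -1) :
    z % 5 = 0 ∧ index n x e z = z / 5 ∨ z % 5 = 1 ∧ index n x e z = z / 5 - 1 ∨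
      z % 5 = 3 - e ∧ index n x e z = z / 5 - x ∨ z % 5 = 3 ∧ index n x e z = z / 5 - n ∨
      z % 5 = 3 + e ∧ index n x e z = z / 5 + x := by
  unfold index offset
  split_ifs <;> omega

theorem eq_of_dvd_of_abs_lt {n D : ℤ} (hdvd : 2 * n ∣ D) (h₁ : -(4 * n) < D) (h₂ : D < 4 * n) :
    D = -(2 * n) ∨ D = 0 ∨ D = 2 * n := by
  obtain ⟨k, rfl⟩ := hdvd
  have hn : 0 < n := by linarith
  have hk₁ : -2 < k := by nlinarith
  have hk₂ : k < 2 := by nlinarith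
  obtain rfl | rfl | rfl : k = -1 ∨ k = 0 ∨ k = 1 := by omega
  all_goals omega

theorem two_mul_dvd {n D : ℤ} (hD : D = -(2 * n) ∨ D = 0 ∨ D = 2 * n) : 2 * n ∣ D := by
  obtain rfl | rfl | rfl := hD <;> simp

/-- The occurrences of a letter are separated by the cyclic sequence of gaps `6, a, b, b, a`,
where `a = 5 * x - 3 - e` and `b = 5 * (n - x) + e`. This relation says that `g, g'` are the gaps
that follow the position `p` and `h, h'` are the ones that precede it, in order of distance. -/
def HasGaps (n x e p g g' h h' : ℤ) : Prop :=
  (p % 5 = 0 ∧ index n x e p = p / 5 ∧ g = 6 ∧ g' = 5 * x - 3 - e ∧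
    h = 5 * x - 3 - e ∧ h' = 5 * (n - x) + e) ∨
  (p % 5 = 1 ∧ index n x e p = p / 5 - 1 ∧ g = 5 * x - 3 - e ∧ g' = 5 * (n - x) + e ∧
    h = 6 ∧ h' = 5 * x - 3 - e) ∨
  (p % 5 = 3 - e ∧ index n x e p = p / 5 - x ∧ g = 5 * (n - x) + e ∧ g' = 5 * (n - x) + e ∧
    h = 5 * x - 3 - e ∧ h' = 6) ∨
  (p % 5 = 3 ∧ index n x e p = p / 5 - n ∧ g = 5 * (n - x) + e ∧ g' = 5 * x - 3 - e ∧
    h = 5 * (n - x) + e ∧ h' = 5 * x - 3 - e) ∨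
  (p % 5 = 3 + e ∧ index n x e p = p / 5 + x ∧ g = 5 * x - 3 - e ∧ g' = 6 ∧
    h = 5 * (n - x) + e ∧ h' = 5 * (n - x) + e)

theorem exists_hasGaps (n x p : ℤ) {e : ℤ} (he : e = 1 ∨ e = -1) :
    ∃ g g' h h', HasGaps n x e p g g' h h' := by
  unfold HasGaps
  obtain ⟨hs, hi⟩ | ⟨hs, hi⟩ | ⟨hs, hi⟩ | ⟨hs, hi⟩ | ⟨hs, hi⟩ := index_cases n x p he
  · exact ⟨_, _, _, _, .inl ⟨hs, hi, rfl, rfl, rfl, rfl⟩⟩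
  · exact ⟨_, _, _, _, .inr <| .inl ⟨hs, hi, rfl, rfl, rfl, rfl⟩⟩
  · exact ⟨_, _, _, _, .inr <| .inr <| .inl ⟨hs, hi, rfl, rfl, rfl, rfl⟩⟩
  · exact ⟨_, _, _, _, .inr <| .inr <| .inr <| .inl ⟨hs, hi, rfl, rfl, rfl, rfl⟩⟩
  · exact ⟨_, _, _, _, .inr <| .inr <| .inr <| .inr ⟨hs, hi, rfl, rfl, rfl, rfl⟩⟩

section Gaps

variable {n x e p q g g' h h' : ℤ}

theorem HasGaps.add_le (hG : HasGaps n x e p g g' h h') (hx1 : 1 < x) (hxn : x < n)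
    (h1 : 3 * x ≤ 2 * n) (he : n < 2 * x ∧ e = 1 ∨ n = 2 * x ∧ e = -1) (hpq : p < q)
    (hdvd : 2 * n ∣ index n x e q - index n x e p) : p + g ≤ q := by
  by_contra! hlt
  have hq := index_cases n x q (he.imp And.right And.right)
  unfold HasGaps at hG
  obtain ⟨hn, rfl⟩ | ⟨hn, rfl⟩ := he <;>
  obtain hG | hG | hG | hG | hG := hG <;>
  obtain hq | hq | hq | hq | hq := hq <;>
  · have := eq_of_dvd_of_abs_lt hdvd (by omega) (by omega)
    omega

theorem HasGaps.exists_lt (hG : HasGaps n x e p g g' h h') (hx1 : 1 < x) (hxn : x < n)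
    (h1 : 3 * x ≤ 2 * n) (he : n < 2 * x ∧ e = 1 ∨ n = 2 * x ∧ e = -1) {d : ℤ}
    (hd : d = 1 ∨ d = -1 ∨ d = x ∨ d = -x ∨ d = n) :
    ∃ r, p < r ∧ r < p + g ∧ 2 * n ∣ index n x e r - index n x e p - d := by
  unfold HasGaps at hG
  have key (r : ℤ) := index_cases n x r (he.imp And.right And.right)
  suffices ∃ r, p < r ∧ r < p + g ∧ (index n x e r - index n x e p - d = -(2 * n) ∨
      index n x e r - index n x e p - d = 0 ∨ index n x e r - index n x e p - d = 2 * n) by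
    obtain ⟨r, hr, hr', hD⟩ := this
    exact ⟨r, hr, hr', two_mul_dvd hD⟩
  obtain hd | hd | hd | hd | hd := hd
  · refine ⟨p + 5, ?_⟩
    have := key (p + 5)
    obtain ⟨hn, rfl⟩ | ⟨hn, rfl⟩ := he <;> obtain hG | hG | hG | hG | hG := hG <;> omega
  · refine ⟨p + g - 5, ?_⟩
    have := key (p + g - 5)
    obtain ⟨hn, rfl⟩ | ⟨hn, rfl⟩ := he <;> obtain hG | hG | hG | hG | hG := hG <;> omega
  · refine ⟨p + 5 * x - h, ?_⟩
    have := key (p + 5 * x - h)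
    obtain ⟨hn, rfl⟩ | ⟨hn, rfl⟩ := he <;> obtain hG | hG | hG | hG | hG := hG <;> omega
  · refine ⟨p + g + g' - 5 * x, ?_⟩
    have := key (p + g + g' - 5 * x)
    obtain ⟨hn, rfl⟩ | ⟨hn, rfl⟩ := he <;> obtain hG | hG | hG | hG | hG := hG <;> omega
  · refine ⟨p + 5 * n - h - h', ?_⟩
    have := key (p + 5 * n - h - h')
    obtain ⟨hn, rfl⟩ | ⟨hn, rfl⟩ := he <;> obtain hG | hG | hG | hG | hG := hG <;> omega

end Gaps

/-- Between two positions of the letter `u` there is a position of the letter `u + d`. -/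
theorem exists_index_between {n x e p q d : ℤ} (hx1 : 1 < x) (hxn : x < n)
    (h1 : 3 * x ≤ 2 * n) (he : n < 2 * x ∧ e = 1 ∨ n = 2 * x ∧ e = -1) (hpq : p < q)
    (hdvd : 2 * n ∣ index n x e q - index n x e p)
    (hd : d = 1 ∨ d = -1 ∨ d = x ∨ d = -x ∨ d = n) :
    ∃ r, p < r ∧ r < q ∧ 2 * n ∣ index n x e r - index n x e p - d := by
  obtain ⟨g, g', h, h', hG⟩ := exists_hasGaps n x p (he.imp And.right And.right)
  obtain ⟨r, hpr, hrg, hr⟩ := hG.exists_lt hx1 hxn h1 he hd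
  exact ⟨r, hpr, hrg.trans_le (hG.add_le hx1 hxn h1 he hpq hdvd), hr⟩

theorem alternate_map_range {V : Type*} [DecidableEq V] (f : ℕ → V) (M : ℕ) (u v : V) :
    Alternate ((List.range M).map f) u v ↔
      ∀ p q, p < q → q < M → f p = f q → (f p = u ∨ f p = v) →
        ∃ r, p < r ∧ r < q ∧ (f r = u ∨ f r = v) ∧ f r ≠ f p := by
  set L := (List.range M).filter fun p => decide (f p = u ∨ f p = v) with hL
  have hmem (p : ℕ) : p ∈ L ↔ p < M ∧ (f p = u ∨ f p = v) := by simp [hL]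
  have hsorted : L.Pairwise (· < ·) := List.pairwise_lt_range.filter _
  have hmono {i j : ℕ} (hi : i < L.length) (hj : j < L.length) : L[i] < L[j] ↔ i < j := by
    have hlt := List.pairwise_iff_getElem.mp hsorted
    refine ⟨fun h => ?_, hlt i j hi hj⟩
    by_contra! hji
    obtain rfl | hji := hji.eq_or_lt
    · exact h.false
    · exact (hlt j i hj hi hji).asymm h
  have halt : Alternate ((List.range M).map f) u v ↔
      ∀ (i : ℕ) (_ : i + 1 < L.length), f L[i] ≠ f L[i + 1] := by
    unfold Alternate
    rw [List.filter_map]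
    exact (List.isChain_map f).trans List.isChain_iff_getElem
  rw [halt]
  constructor
  · intro hchain p q hpq hq hfpq hfp
    obtain ⟨i, hi, rfl⟩ := List.getElem_of_mem ((hmem p).2 ⟨hpq.trans hq, hfp⟩)
    obtain ⟨j, hj, rfl⟩ := List.getElem_of_mem ((hmem q).2 ⟨hq, hfpq ▸ hfp⟩)
    have hij := (hmono hi hj).1 hpq
    have hne := hchain i (by omega)
    have hj' : i + 1 ≠ j := by
      rintro rfl
      exact hne hfpq
    exact ⟨L[i + 1], (hmono _ _).2 (by omega), (hmono _ _).2 (by omega),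
      ((hmem _).1 (List.getElem_mem _)).2, hne.symm⟩
  · intro hbetween i hi heq
    have hmem' := (hmem _).1 (List.getElem_mem hi)
    obtain ⟨r, hir, hri, hr, -⟩ := hbetween L[i] L[i + 1] ((hmono _ _).2 (by omega)) hmem'.1 heq
      ((hmem _).1 (List.getElem_mem _)).2
    obtain ⟨k, hk, rfl⟩ := List.getElem_of_mem ((hmem r).2 ⟨hri.trans hmem'.1, hr⟩)
    have := (hmono _ _).1 hir
    have := (hmono _ _).1 hri
    omega

theorem alternate_comm {V : Type*} [DecidableEq V] {w : List V} {u v : V} :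
    Alternate w u v ↔ Alternate w v u := by
  simp only [Alternate, or_comm]

/-- The letter at position `p` of the word. -/
def letter (n x : ℕ) (e : ℤ) (p : ℕ) : ZMod (2 * n) := (index n x e p : ℤ)

theorem letter_block (n x : ℕ) (e : ℤ) (j s : ℕ) (hs : s < 5) :
    letter n x e (j * 5 + s) = (j : ZMod (2 * n)) + (offset n x e s : ℤ) := by
  have h1 : ((j * 5 + s : ℕ) : ℤ) / 5 = j := by omega
  have h2 : ((j * 5 + s : ℕ) : ℤ) % 5 = s := by omega
  rw [letter, index, h1, h2]
  push_cast
  rfl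

theorem intCast_eq_add_iff (n : ℕ) (a b d : ℤ) :
    (a : ZMod (2 * n)) = b + d ↔ 2 * (n : ℤ) ∣ a - b - d := by
  have := ZMod.intCast_eq_intCast_iff_dvd_sub (b + d) a (2 * n)
  push_cast at this
  rw [eq_comm, this, sub_sub]

theorem count_letter {n : ℕ} (hn : 0 < n) (x : ℕ) (e : ℤ) (v : ZMod (2 * n)) :
    ((List.range (2 * n * 5)).map (letter n x e)).count v = 5 := by
  have : NeZero (2 * n) := ⟨by omega⟩
  have hsum (m : ℕ) : ((List.range (m * 5)).map (letter n x e)).count v =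
      ∑ j ∈ Finset.range m, ∑ s ∈ Finset.range 5,
        if (j : ZMod (2 * n)) + (offset n x e s : ℤ) = v then 1 else 0 := by
    induction m with
    | zero => simp
    | succ m ih =>
      rw [add_one_mul, List.range_add, List.map_append, List.count_append, ih,
        Finset.sum_range_succ, List.map_map]
      congr 1
      rw [Finset.sum_congr rfl fun s hs => by rw [← letter_block n x e m s (Finset.mem_range.1 hs)]]
      simp [-Finset.sum_boole, List.range_succ, Finset.sum_range_succ, List.count_cons]
      ring
  have hone (c : ZMod (2 * n)) :
      (∑ j ∈ Finset.range (2 * n), if (j : ZMod (2 * n)) + c = v then 1 else 0) = 1 := by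
    have hiff (j : ℕ) (hj : j ∈ Finset.range (2 * n)) :
        (j : ZMod (2 * n)) + c = v ↔ (v - c).val = j := by
      rw [← eq_sub_iff_add_eq]
      constructor
      · intro h
        rw [← h, ZMod.val_natCast_of_lt (Finset.mem_range.1 hj)]
      · rintro rfl
        exact ZMod.natCast_zmod_val _
    rw [Finset.sum_congr rfl fun j hj => by rw [if_congr (hiff j hj) rfl rfl],
      Finset.sum_ite_eq, if_pos (Finset.mem_range.2 (ZMod.val_lt _))]
  rw [hsum, Finset.sum_comm]
  simp [hone]

section Adjacency

variable {n x : ℕ} {e : ℤ}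

theorem neg_natCast_self : -(n : ZMod (2 * n)) = n := by
  have := ZMod.natCast_self (2 * n)
  push_cast at this
  linear_combination -this

/-- Adjacency in terms of a set of jumps that is symmetric modulo `2 * n`. -/
theorem adj_iff_exists (u v : ZMod (2 * n)) (huv : u ≠ v) :
    (SimpleGraph.circulantGraph {((1 : ℕ) : ZMod (2 * n)), ((x : ℕ) : ZMod (2 * n)),
      ((n : ℕ) : ZMod (2 * n))}).Adj u v ↔
      ∃ d : ℤ, (d = 1 ∨ d = -1 ∨ d = x ∨ d = -x ∨ d = n) ∧ v = u + d := by
  simp only [SimpleGraph.circulantGraph_adj, Set.mem_insert_iff, Set.mem_singleton_iff,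
    or_and_right, exists_or, exists_eq_left, Int.cast_neg, Int.cast_one, Int.cast_natCast,
    Nat.cast_one]
  have hswap (c : ZMod (2 * n)) : u - v = c ↔ v = u + -c := by grind
  have hkeep (c : ZMod (2 * n)) : v - u = c ↔ v = u + c := by grind
  simp only [hswap, hkeep, neg_natCast_self]
  tauto

theorem exists_between (hx1 : 1 < x) (hxn : x < n) (h1 : 3 * x ≤ 2 * n)
    (he : n < 2 * x ∧ e = 1 ∨ n = 2 * x ∧ e = -1) {p q : ℕ} (hpq : p < q)
    (hletter : letter n x e p = letter n x e q) {d : ℤ}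
    (hd : d = 1 ∨ d = -1 ∨ d = x ∨ d = -x ∨ d = n) :
    ∃ r, p < r ∧ r < q ∧ letter n x e r = letter n x e p + d := by
  have hdvd : 2 * (n : ℤ) ∣ index n x e q - index n x e p := by
    simpa using (intCast_eq_add_iff n (index n x e q) (index n x e p) 0).1
      (by simpa [letter] using hletter.symm)
  obtain ⟨r, hpr, hrq, hr⟩ := exists_index_between (by omega) (by omega) (by omega) (by omega)
    (Int.ofNat_lt.2 hpq) hdvd hd
  lift r to ℕ using by omega
  exact ⟨r, by omega, by omega, (intCast_eq_add_iff n _ _ d).2 hr⟩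

/-- All letters between the positions `5 * u` and `5 * u + 6` of the letter `u` are neighbours
of `u`. -/
theorem exists_add_of_alternate (he : e = 1 ∨ e = -1) {u v : ZMod (2 * n)} {j : ℕ}
    (hj : (j : ZMod (2 * n)) = u) (hjn : j + 1 < 2 * n)
    (halt : Alternate ((List.range (2 * n * 5)).map (letter n x e)) u v) :
    ∃ d : ℤ, (d = 1 ∨ d = -1 ∨ d = x ∨ d = -x ∨ d = n) ∧ v = u + d := by
  have hletter (k : ℕ) : letter n x e (j * 5 + k) = u + (index n x e k : ℤ) := by
    have h1 : ((j * 5 + k : ℕ) : ℤ) / 5 = j + (k : ℤ) / 5 := by omega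
    have h2 : ((j * 5 + k : ℕ) : ℤ) % 5 = (k : ℤ) % 5 := by omega
    rw [letter, index, index, h1, h2, ← hj]
    push_cast
    ring
  have h0 : letter n x e (j * 5 + 0) = u := by
    have := index_cases n x 0 he
    rw [hletter, Nat.cast_zero, show index n x e 0 = 0 by omega, Int.cast_zero, add_zero]
  have h6 : letter n x e (j * 5 + 6) = u := by
    have := index_cases n x 6 he
    rw [hletter, Nat.cast_ofNat, show index n x e 6 = 0 by omega, Int.cast_zero, add_zero]
  obtain ⟨r, hjr, hrj, hr, hru⟩ := (alternate_map_range _ _ _ _).1 halt (j * 5 + 0) (j * 5 + 6)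
    (by omega) (by omega) (h0.trans h6.symm) (.inl h0)
  rw [h0] at hru
  obtain ⟨k, rfl⟩ := Nat.exists_eq_add_of_lt hjr
  rw [show j * 5 + 0 + k + 1 = j * 5 + (k + 1) by omega] at hr hru
  have hv : v = u + (index n x e (k + 1 : ℕ) : ℤ) := by
    rw [← hletter, hr.resolve_left hru]
  obtain hn | hn : index n x e (k + 1 : ℕ) = -n ∨ index n x e (k + 1 : ℕ) ≠ -n := em _
  · refine ⟨n, by simp, ?_⟩
    rw [hv, hn, Int.cast_neg, Int.cast_natCast, neg_natCast_self]
  · have := index_cases n x (k + 1 : ℕ) he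
    exact ⟨_, by omega, hv⟩

theorem adj_iff_alternate [NeZero (2 * n)] (hx1 : 1 < x) (hxn : x < n) (h1 : 3 * x ≤ 2 * n)
    (he : n < 2 * x ∧ e = 1 ∨ n = 2 * x ∧ e = -1) {u v : ZMod (2 * n)} (huv : u ≠ v) :
    (SimpleGraph.circulantGraph {((1 : ℕ) : ZMod (2 * n)), ((x : ℕ) : ZMod (2 * n)),
      ((n : ℕ) : ZMod (2 * n))}).Adj u v ↔
      Alternate ((List.range (2 * n * 5)).map (letter n x e)) u v := by
  constructor
  · intro hadj
    rw [alternate_map_range]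
    rintro p q hpq - hletter (hp | hp)
    · obtain ⟨d, hd, hv⟩ := (adj_iff_exists u v huv).1 hadj
      obtain ⟨r, hpr, hrq, hr⟩ := exists_between hx1 hxn h1 he hpq hletter hd
      rw [hp, ← hv] at hr
      exact ⟨r, hpr, hrq, .inr hr, by rwa [hr, hp, ne_comm]⟩
    · obtain ⟨d, hd, hu⟩ := (adj_iff_exists v u huv.symm).1 hadj.symm
      obtain ⟨r, hpr, hrq, hr⟩ := exists_between hx1 hxn h1 he hpq hletter hd
      rw [hp, ← hu] at hr
      exact ⟨r, hpr, hrq, .inl hr, by rwa [hr, hp]⟩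
  · intro halt
    have he' : e = 1 ∨ e = -1 := he.imp And.right And.right
    obtain hu | hu := lt_or_ge (u.val + 1) (2 * n)
    · exact (adj_iff_exists u v huv).2
        (exists_add_of_alternate he' (ZMod.natCast_zmod_val u) hu halt)
    · have hv : v.val + 1 < 2 * n := by
        have := ZMod.val_lt u
        have := ZMod.val_lt v
        have : u.val ≠ v.val := fun h => huv (ZMod.val_injective _ h)
        omega
      exact ((adj_iff_exists v u huv.symm).2
        (exists_add_of_alternate he' (ZMod.natCast_zmod_val v) hv (alternate_comm.1 halt))).symm

end Adjacency

end CirculantWord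

theorem stmt13 (n x : ℕ) (hn : 3 ≤ n) (hx1 : 1 < x) (hxn : x < n)
    (h0 : n ≤ 2*x) (h1 : 3*x ≤ 2*n) :
    WordRepresentable (SimpleGraph.circulantGraph {((1 : ℕ) : ZMod (2*n)), ((x : ℕ) : ZMod (2*n)), ((n : ℕ) : ZMod (2*n))}) ∧
      ∃ w : List (ZMod (2*n)), Represents (SimpleGraph.circulantGraph {((1 : ℕ) : ZMod (2*n)), ((x : ℕ) : ZMod (2*n)), ((n : ℕ) : ZMod (2*n))}) w ∧ IsKUniform w 5 := by
  suffices ∃ w : List (ZMod (2*n)), Represents (SimpleGraph.circulantGraph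
      {((1 : ℕ) : ZMod (2*n)), ((x : ℕ) : ZMod (2*n)), ((n : ℕ) : ZMod (2*n))}) w ∧
      IsKUniform w 5 from ⟨this.imp fun _ h => h.1, this⟩
  obtain ⟨e, he⟩ : ∃ e : ℤ, n < 2 * x ∧ e = 1 ∨ n = 2 * x ∧ e = -1 := by
    obtain h | h := h0.lt_or_eq
    · exact ⟨1, .inl ⟨h, rfl⟩⟩
    · exact ⟨-1, .inr ⟨h, rfl⟩⟩
  have : NeZero (2 * n) := ⟨by omega⟩
  have hcount := CirculantWord.count_letter (n := n) (by omega) x e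
  exact ⟨_, ⟨fun v => List.count_pos_iff.1 (by rw [hcount]; norm_num),
    fun u v huv => CirculantWord.adj_iff_alternate hx1 hxn h1 he huv⟩, hcount⟩
end

section
/- Let n > 3 be an integer. Then the 5-regular circulant graph G = C_{2n}(2,1,n) (jump set {1, 2, n} on 2n vertices) is word-representable, and moreover there exists a 3-uniform word representing G; in particular R(G) ≤ 3. -/
/-- A list filtered by `P` has distinct neighbours iff any two positions carrying letters in `P`
with no letter of `P` strictly between them carry different letters. -/
theorem chain_filter_map_range {V : Type*} (f : ℕ → V) (P : V → Prop) [DecidablePred P] (N : ℕ) :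
    (((List.range N).map f).filter (fun z => decide (P z))).IsChain (· ≠ ·) ↔
      ∀ p q, p < q → q < N → P (f p) → P (f q) → (∀ r, p < r → r < q → ¬ P (f r)) →
        f p ≠ f q := by
  have last : ∀ N a, a ∈ (((List.range N).map f).filter (fun z => decide (P z))).getLast? ↔
      ∃ p < N, P (f p) ∧ (∀ r, p < r → r < N → ¬ P (f r)) ∧ f p = a := by
    intro N
    induction N with
    | zero => simp
    | succ N ih =>
      intro a
      rw [List.range_succ, List.map_append, List.filter_append]
      by_cases h : P (f N)
      · simp only [List.map_cons, List.map_nil, List.filter_cons, h, decide_true, if_true,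
          List.filter_nil, List.getLast?_append, List.getLast?_singleton, Option.some_or,
          Option.mem_some_iff]
        constructor
        · rintro rfl
          exact ⟨N, by omega, h, fun r _ _ => by omega, rfl⟩
        · rintro ⟨p, hp, -, hr, rfl⟩
          rcases Nat.lt_succ_iff_lt_or_eq.mp hp with hlt | rfl
          · exact absurd h (hr N hlt (by omega))
          · rfl
      · simp only [List.map_cons, List.map_nil, List.filter_cons, h, decide_false,
          List.filter_nil, List.append_nil, Bool.false_eq_true, if_false]
        rw [ih]
        constructor
        · rintro ⟨p, hp, hP, hr, rfl⟩
          refine ⟨p, by omega, hP, fun r h1 h2 => ?_, rfl⟩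
          rcases Nat.lt_succ_iff_lt_or_eq.mp h2 with hlt | rfl
          · exact hr r h1 hlt
          · exact h
        · rintro ⟨p, hp, hP, hr, rfl⟩
          have : p ≠ N := by rintro rfl; exact h hP
          exact ⟨p, by omega, hP, fun r h1 h2 => hr r h1 (by omega), rfl⟩
  induction N with
  | zero => simp
  | succ N ih =>
    rw [List.range_succ, List.map_append, List.filter_append, List.isChain_append,
      propext ih]
    constructor
    · rintro ⟨h1, -, h3⟩ p q hpq hq hp hPq hr
      rcases Nat.lt_succ_iff_lt_or_eq.mp hq with hlt | rfl
      · exact h1 p q hpq hlt hp hPq hr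
      · exact h3 (f p) ((last q _).2 ⟨p, hpq, hp, hr, rfl⟩) (f q) (by simp [hPq])
    · intro h
      refine ⟨fun p q hpq hq => h p q hpq (by omega), ?_, ?_⟩
      · by_cases hN : P (f N) <;> simp [hN]
      · intro a ha b hb
        obtain ⟨p, hp, hP, hr, rfl⟩ := (last N a).1 ha
        by_cases hN : P (f N)
        · simp [hN] at hb
          subst hb
          exact h p N hp (by omega) hP hN hr
        · simp [hN] at hb

theorem Alternate.comm {V : Type*} [DecidableEq V] (w : List V) (x y : V) :
    Alternate w x y ↔ Alternate w y x := by
  simp only [Alternate, or_comm]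

/-- Letters with exactly three occurrences each alternate iff their occurrences interleave. -/
theorem alternate_map_range_iff_s14 {V : Type*} [DecidableEq V] (f : ℕ → V) (N : ℕ) {x y : V}
    (hxy : x ≠ y) {p₁ p₂ p₃ q₁ q₂ q₃ : ℕ} (hp₁ : p₁ < p₂) (hp₂ : p₂ < p₃) (hp₃ : p₃ < N)
    (hq₁ : q₁ < q₂) (hq₂ : q₂ < q₃) (hq₃ : q₃ < N)
    (hx : ∀ p < N, f p = x ↔ p = p₁ ∨ p = p₂ ∨ p = p₃)
    (hy : ∀ p < N, f p = y ↔ p = q₁ ∨ p = q₂ ∨ p = q₃) :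
    Alternate ((List.range N).map f) x y ↔
      (p₁ < q₁ ∧ q₁ < p₂ ∧ p₂ < q₂ ∧ q₂ < p₃ ∧ p₃ < q₃) ∨
      (q₁ < p₁ ∧ p₁ < q₂ ∧ q₂ < p₂ ∧ p₂ < q₃ ∧ q₃ < p₃) := by
  have disj : ∀ p < N, (p = p₁ ∨ p = p₂ ∨ p = p₃) → (p = q₁ ∨ p = q₂ ∨ p = q₃) → False :=
    fun p hp h1 h2 => hxy (((hx p hp).2 h1).symm.trans ((hy p hp).2 h2))
  have d1 := disj p₁ (by omega)
  have d2 := disj p₂ (by omega)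
  have d3 := disj p₃ (by omega)
  have step := chain_filter_map_range f (fun z => z = x ∨ z = y) N
  refine Iff.trans step ?_
  constructor
  · intro h
    have gap : ∀ p q, p < q → q < N → (f p = x ∧ f q = x ∨ f p = y ∧ f q = y) →
        ∃ r, p < r ∧ r < q ∧ (f r = x ∨ f r = y) := by
      intro p q hpq hq hh
      by_contra hc
      push Not at hc
      refine h p q hpq hq (by tauto) (by tauto) (fun r h1 h2 => ?_) ?_
      · have := hc r h1 h2
        tauto
      · rcases hh with ⟨h1, h2⟩ | ⟨h1, h2⟩ <;> rw [h1, h2]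
    obtain ⟨a, ha1, ha2, ha⟩ := gap p₁ p₂ hp₁ (by omega)
      (.inl ⟨(hx _ (by omega)).2 (by simp), (hx _ (by omega)).2 (by simp)⟩)
    obtain ⟨b, hb1, hb2, hb⟩ := gap p₂ p₃ hp₂ (by omega)
      (.inl ⟨(hx _ (by omega)).2 (by simp), (hx _ (by omega)).2 (by simp)⟩)
    obtain ⟨c, hc1, hc2, hc⟩ := gap q₁ q₂ hq₁ (by omega)
      (.inr ⟨(hy _ (by omega)).2 (by simp), (hy _ (by omega)).2 (by simp)⟩)
    obtain ⟨d, hd1, hd2, hd⟩ := gap q₂ q₃ hq₂ (by omega)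
      (.inr ⟨(hy _ (by omega)).2 (by simp), (hy _ (by omega)).2 (by simp)⟩)
    rw [hx _ (by omega), hy _ (by omega)] at ha hb hc hd
    have ha' : a = q₁ ∨ a = q₂ ∨ a = q₃ := by omega
    have hb' : b = q₁ ∨ b = q₂ ∨ b = q₃ := by omega
    have hc' : c = p₁ ∨ c = p₂ ∨ c = p₃ := by omega
    have hd' : d = p₁ ∨ d = p₂ ∨ d = p₃ := by omega
    clear ha hb hc hd step h gap d1 d2 d3
    omega
  · intro h p q hpq hq hp hq' hr heq
    have out : ∀ r < N, p < r → r < q →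
        ¬ ((r = p₁ ∨ r = p₂ ∨ r = p₃) ∨ (r = q₁ ∨ r = q₂ ∨ r = q₃)) := by
      intro r hrN h1 h2
      rw [← hx r hrN, ← hy r hrN]
      exact hr r h1 h2
    have o1 := out p₁ (by omega)
    have o2 := out p₂ (by omega)
    have o3 := out p₃ (by omega)
    have o4 := out q₁ (by omega)
    have o5 := out q₂ (by omega)
    have o6 := out q₃ (by omega)
    rcases hp with hp | hp
    · have hq2 := (hx q hq).1 (heq ▸ hp)
      have hp2 := (hx p (by omega)).1 hp
      clear step out disj d1 d2 d3 hq'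
      omega
    · have hq2 := (hy q hq).1 (heq ▸ hp)
      have hp2 := (hy p (by omega)).1 hp
      clear step out disj d1 d2 d3 hq'
      omega

/-- The letters of the word `∏ i, (i) (i - 2) (i + n)`, with indices and letters modulo `2 * n`. -/
def letterAt (n p : ℕ) : ℕ :=
  if p % 3 = 0 then p / 3
  else if p % 3 = 1 then (if p / 3 < 2 then p / 3 + 2 * n - 2 else p / 3 - 2)
  else (if p / 3 < n then p / 3 + n else p / 3 - n)

theorem letterAt_lt {n p : ℕ} (hn : 3 < n) (hp : p < 6 * n) : letterAt n p < 2 * n := by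
  unfold letterAt
  split_ifs <;> omega

/-- The three positions of a letter `a`, in increasing order. -/
theorem exists_positions {n a : ℕ} (hn : 3 < n) (ha : a < 2 * n) :
    ∃ p₁ p₂ p₃, p₁ < p₂ ∧ p₂ < p₃ ∧ p₃ < 6 * n ∧
      (∀ p < 6 * n, letterAt n p = a ↔ p = p₁ ∨ p = p₂ ∨ p = p₃) ∧
      ((a < n ∧ p₁ = 3 * a ∧ p₂ = 3 * a + 7 ∧ p₃ = 3 * a + 3 * n + 2) ∨
       (n ≤ a ∧ a + 2 < 2 * n ∧ p₁ + 3 * n = 3 * a + 2 ∧ p₂ = 3 * a ∧ p₃ = 3 * a + 7) ∨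
       (2 * n ≤ a + 2 ∧ p₁ + 6 * n = 3 * a + 7 ∧ p₂ + 3 * n = 3 * a + 2 ∧ p₃ = 3 * a)) := by
  rcases lt_or_ge a n with h | h
  · refine ⟨3 * a, 3 * a + 7, 3 * a + 3 * n + 2, by omega, by omega, by omega, ?_, by omega⟩
    intro p hp
    unfold letterAt
    split_ifs <;> omega
  rcases lt_or_ge (a + 2) (2 * n) with h' | h'
  · refine ⟨3 * a + 2 - 3 * n, 3 * a, 3 * a + 7, by omega, by omega, by omega, ?_, by omega⟩
    intro p hp
    unfold letterAt
    split_ifs <;> omega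
  · refine ⟨3 * a + 7 - 6 * n, 3 * a + 2 - 3 * n, 3 * a, by omega, by omega, by omega, ?_, by omega⟩
    intro p hp
    unfold letterAt
    split_ifs <;> omega

theorem ZMod.natCast_inj_of_lt {m a b : ℕ} (ha : a < m) (hb : b < m) :
    (a : ZMod m) = (b : ZMod m) ↔ a = b := by
  rw [ZMod.natCast_eq_natCast_iff]
  exact ⟨fun h => Nat.ModEq.eq_of_lt_of_lt h ha hb, fun h => h ▸ rfl⟩

theorem circulantGraph_adj_natCast_iff_s14 {n a b : ℕ} (hn : 3 < n) (hab : a < b) (hb : b < 2 * n) :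
    (SimpleGraph.circulantGraph {((1 : ℕ) : ZMod (2 * n)), ((2 : ℕ) : ZMod (2 * n)),
      ((n : ℕ) : ZMod (2 * n))}).Adj (a : ZMod (2 * n)) (b : ZMod (2 * n)) ↔
      b = a + 1 ∨ b = a + 2 ∨ b = a + n ∨ b + 1 = a + 2 * n ∨ b + 2 = a + 2 * n := by
  have h1 : (b : ZMod (2 * n)) - a = ((b - a : ℕ) : ZMod (2 * n)) := by
    rw [Nat.cast_sub hab.le]
  have h2 : (a : ZMod (2 * n)) - b = ((2 * n - (b - a) : ℕ) : ZMod (2 * n)) := by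
    rw [Nat.cast_sub (by omega), Nat.cast_sub hab.le, ZMod.natCast_self]
    ring
  have hne : (a : ZMod (2 * n)) ≠ b := by
    rw [Ne, ZMod.natCast_inj_of_lt (by omega) hb]
    omega
  rw [SimpleGraph.circulantGraph, SimpleGraph.fromRel_adj]
  simp only [h1, h2, Set.mem_insert_iff, Set.mem_singleton_iff]
  rw [ZMod.natCast_inj_of_lt (by omega) (by omega), ZMod.natCast_inj_of_lt (by omega) (by omega),
    ZMod.natCast_inj_of_lt (by omega) (by omega), ZMod.natCast_inj_of_lt (by omega) (by omega),
    ZMod.natCast_inj_of_lt (by omega) (by omega), ZMod.natCast_inj_of_lt (by omega) (by omega)]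
  simp only [hne, ne_eq, not_false_eq_true, true_and]
  omega

theorem circulantGraph_adj_iff_alternate {n a b : ℕ} (hn : 3 < n) (hab : a < b)
    (hb : b < 2 * n) :
    (SimpleGraph.circulantGraph {((1 : ℕ) : ZMod (2 * n)), ((2 : ℕ) : ZMod (2 * n)),
      ((n : ℕ) : ZMod (2 * n))}).Adj (a : ZMod (2 * n)) (b : ZMod (2 * n)) ↔
      Alternate ((List.range (6 * n)).map fun p => (letterAt n p : ZMod (2 * n)))
        (a : ZMod (2 * n)) (b : ZMod (2 * n)) := by
  have hne : (a : ZMod (2 * n)) ≠ b := by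
    rw [Ne, ZMod.natCast_inj_of_lt (by omega) hb]
    omega
  obtain ⟨p₁, p₂, p₃, hp₁, hp₂, hp₃, hp, hpa⟩ := exists_positions hn (hab.trans hb)
  obtain ⟨q₁, q₂, q₃, hq₁, hq₂, hq₃, hq, hqb⟩ := exists_positions hn hb
  rw [circulantGraph_adj_natCast_iff_s14 hn hab hb,
    alternate_map_range_iff_s14 _ _ hne hp₁ hp₂ hp₃ hq₁ hq₂ hq₃
      (fun p h => (ZMod.natCast_inj_of_lt (letterAt_lt hn h) (hab.trans hb)).trans (hp p h))
      (fun p h => (ZMod.natCast_inj_of_lt (letterAt_lt hn h) hb).trans (hq p h))]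
  clear hp hq hne
  rcases hpa with hpa | hpa | hpa <;> rcases hqb with hqb | hqb | hqb <;> omega

theorem isKUniform_letterAt {n : ℕ} (hn : 3 < n) :
    IsKUniform ((List.range (6 * n)).map fun p => (letterAt n p : ZMod (2 * n))) 3 := by
  have : NeZero (2 * n) := ⟨by omega⟩
  intro v
  obtain ⟨p₁, p₂, p₃, hp₁, hp₂, hp₃, hp, -⟩ := exists_positions hn (ZMod.val_lt v)
  have key : (Finset.range (6 * n)).filter (fun p => (letterAt n p : ZMod (2 * n)) = v) =
      {p₁, p₂, p₃} := by
    ext p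
    simp only [Finset.mem_filter, Finset.mem_range, Finset.mem_insert, Finset.mem_singleton]
    constructor
    · rintro ⟨h, hv⟩
      rw [← hp p h, ← hv, ZMod.val_cast_of_lt (letterAt_lt hn h)]
    · intro h
      have hlt : p < 6 * n := by omega
      refine ⟨hlt, ?_⟩
      rw [(hp p hlt).2 h, ZMod.natCast_zmod_val]
  have card : ((Finset.range (6 * n)).filter
      (fun p => (letterAt n p : ZMod (2 * n)) = v)).card = 3 := by
    rw [key, Finset.card_eq_three]
    exact ⟨p₁, p₂, p₃, by omega, by omega, by omega, rfl⟩
  rw [← card, List.count, List.countP_map, List.countP_eq_length_filter]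
  rfl

theorem stmt14 (n : ℕ) (hn : 3 < n) :
    WordRepresentable (SimpleGraph.circulantGraph {((1 : ℕ) : ZMod (2*n)), ((2 : ℕ) : ZMod (2*n)), ((n : ℕ) : ZMod (2*n))}) ∧
      ∃ w : List (ZMod (2*n)), Represents (SimpleGraph.circulantGraph {((1 : ℕ) : ZMod (2*n)), ((2 : ℕ) : ZMod (2*n)), ((n : ℕ) : ZMod (2*n))}) w ∧ IsKUniform w 3 := by
  have : NeZero (2 * n) := ⟨by omega⟩
  have huni := isKUniform_letterAt hn
  suffices h : Represents _ _ from ⟨⟨_, h⟩, _, h, huni⟩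
  refine ⟨fun v => List.count_pos_iff.1 (by rw [huni v]; norm_num), fun x y hxy => ?_⟩
  have hx := ZMod.natCast_zmod_val x
  have hy := ZMod.natCast_zmod_val y
  have hne : x.val ≠ y.val := fun h => hxy (ZMod.val_injective _ h)
  rcases lt_or_gt_of_ne hne with h | h
  · have := circulantGraph_adj_iff_alternate hn h (ZMod.val_lt y)
    rwa [hx, hy] at this
  · have := circulantGraph_adj_iff_alternate hn h (ZMod.val_lt x)
    rw [hx, hy] at this
    rwa [SimpleGraph.adj_comm, Alternate.comm]
end

section
/- Let n ≥ 2 be odd and let a, b be integers with 0 < a < n, 0 < b < n, a ≠ b, where b is odd and a is even. Suppose there exist positive integers p and q with p > 2, 1 < q < n, p ∣ a, q ∣ b, p·q = 2n, and gcd(p, q) = 1. Then p is even and the circulant graph C_{2n}(a,b,n) is isomorphic to the Cartesian product C_p({p/2, b/q}) □ C_q({a/p}) of a 3-regular circulant graph and a 2-regular circulant graph. -/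
namespace SimpleGraph

/-- An additive equivalence onto a product that carries `S` to the union of `S₁ × {0}` and
`{0} × S₂` is an isomorphism from the circulant graph of `S` to the Cartesian product of the
circulant graphs of `S₁` and `S₂`. -/
def circulantGraphIsoBoxProd {G A B : Type*} [AddGroup G] [AddGroup A] [AddGroup B]
    (e : G ≃+ A × B) (S : Set G) (S₁ : Set A) (S₂ : Set B)
    (hS : ∀ x, x ∈ S ↔ (e x).1 ∈ S₁ ∧ (e x).2 = 0 ∨ (e x).1 = 0 ∧ (e x).2 ∈ S₂) :
    circulantGraph S ≃g circulantGraph S₁ □ circulantGraph S₂ where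
  toEquiv := e.toEquiv
  map_rel_iff' := by
    intro x y
    have hne : x = y ↔ (e x).1 = (e y).1 ∧ (e x).2 = (e y).2 := by
      rw [← Prod.ext_iff, e.injective.eq_iff]
    simp only [boxProd_adj, circulantGraph_adj, hS, map_sub, Prod.fst_sub, Prod.snd_sub,
      AddEquiv.toEquiv_eq_coe, EquivLike.coe_coe, sub_eq_zero, hne]
    grind

end SimpleGraph

namespace ZMod

/-- The Chinese remainder isomorphism rescaled so that its inverse is
`(u, v) ↦ q * u + p * v`. -/
def scaledChineseRemainder {p q : ℕ} (h : p.Coprime q) : ZMod (p * q) ≃+ ZMod p × ZMod q :=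
  (chineseRemainder h).toAddEquiv.trans
    ((AddAut.mulLeft (unitOfCoprime q h.symm)⁻¹).prodCongr
      (AddAut.mulLeft (unitOfCoprime p h)⁻¹))

theorem scaledChineseRemainder_natCast {p q : ℕ} (h : p.Coprime q) (u v : ℕ) :
    scaledChineseRemainder h ((q * u + p * v : ℕ) : ZMod (p * q)) =
      ((u : ZMod p), (v : ZMod q)) := by
  have hq : (q : ZMod p) = unitOfCoprime q h.symm := rfl
  have hp : (p : ZMod q) = unitOfCoprime p h := rfl
  have happly (x : ZMod (p * q)) : scaledChineseRemainder h x =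
      (((unitOfCoprime q h.symm)⁻¹ : (ZMod p)ˣ) * (chineseRemainder h x).1,
        ((unitOfCoprime p h)⁻¹ : (ZMod q)ˣ) * (chineseRemainder h x).2) := rfl
  rw [happly, map_natCast, Prod.fst_natCast, Prod.snd_natCast]
  push_cast
  rw [natCast_self, natCast_self, hq, hp]
  simp only [zero_mul, add_zero, zero_add, Units.inv_mul_cancel_left]

end ZMod

theorem stmt15 (n a b p q : ℕ) (hn : 2 ≤ n) (hnodd : Odd n) (haeven : Even a) (hbodd : Odd b)
    (ha0 : 0 < a) (han : a < n) (hb0 : 0 < b) (hbn : b < n) (hab : a ≠ b)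
    (hp : 2 < p) (hq1 : 1 < q) (hqn : q < n)
    (hpa : p ∣ a) (hqb : q ∣ b) (hpq : p * q = 2*n) (hcop : Nat.gcd p q = 1) :
    Even p ∧
      Nonempty
        ((SimpleGraph.circulantGraph {((a : ℕ) : ZMod (2*n)), ((b : ℕ) : ZMod (2*n)), ((n : ℕ) : ZMod (2*n))}) ≃g
          (SimpleGraph.boxProd
            (SimpleGraph.circulantGraph {((p/2 : ℕ) : ZMod p), ((b/q : ℕ) : ZMod p)})
            (SimpleGraph.circulantGraph {((a/p : ℕ) : ZMod q)}))) := by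
  have hqodd : Odd q := hbodd.of_dvd_nat hqb
  have hpeven : Even p := by
    have h : Even (p * q) := hpq ▸ even_two_mul n
    exact (Nat.even_mul.mp h).resolve_right (Nat.not_even_iff_odd.mpr hqodd)
  refine ⟨hpeven, ?_⟩
  obtain ⟨k, rfl⟩ := hpa
  obtain ⟨l, rfl⟩ := hqb
  obtain ⟨m, rfl⟩ := hpeven.two_dvd
  obtain rfl : n = q * m := by linarith
  rw [← hpq, Nat.mul_div_cancel_left k (by lia), Nat.mul_div_cancel_left l (by lia),
    Nat.mul_div_cancel_left m (by lia)]
  have hA := ZMod.scaledChineseRemainder_natCast hcop 0 k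
  have hB := ZMod.scaledChineseRemainder_natCast hcop l 0
  have hN := ZMod.scaledChineseRemainder_natCast hcop m 0
  simp only [mul_zero, zero_add, add_zero, Nat.cast_zero] at hA hB hN
  refine ⟨SimpleGraph.circulantGraphIsoBoxProd (ZMod.scaledChineseRemainder hcop) _ _ _ ?_⟩
  intro x
  simp only [Set.mem_insert_iff, Set.mem_singleton_iff,
    ← (ZMod.scaledChineseRemainder hcop).injective.eq_iff (a := x), hA, hB, hN, Prod.ext_iff]
  tauto
end

section
/- Let n ≥ 2 be even and let a, b be integers with 0 < a < n, 0 < b < n, a ≠ b, where a is even and b is odd. Suppose there exist positive integers p and q with p > 2, 1 < q < n, p ∣ a, q ∣ b, p·q = 2n, and gcd(p, q) = 1. Then p is even and the circulant graph C_{2n}(a,b,n) is isomorphic to the Cartesian product C_p({p/2, b/q}) □ C_q({a/p}) of a 3-regular circulant graph and a 2-regular circulant graph. -/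
/-- An additive isomorphism `G ≃+ A × B` under which the jump set `S` becomes the union of
`T × {0}` and `{0} × U` is an isomorphism from the circulant graph of `S` to the box product of
the circulant graphs of `T` and `U`. -/
def SimpleGraph.circulantGraphIsoBoxProd_s16 {G A B : Type*} [AddGroup G] [AddGroup A] [AddGroup B]
    (e : G ≃+ A × B) {S : Set G} {T : Set A} {U : Set B}
    (h : ∀ g, g ∈ S ↔ ((e g).1 ∈ T ∧ (e g).2 = 0) ∨ ((e g).1 = 0 ∧ (e g).2 ∈ U)) :
    SimpleGraph.circulantGraph S ≃g
      SimpleGraph.boxProd (SimpleGraph.circulantGraph T) (SimpleGraph.circulantGraph U) where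
  toEquiv := e.toEquiv
  map_rel_iff' := by
    intro u v
    have hne : u ≠ v ↔ ¬ ((e u).1 = (e v).1 ∧ (e u).2 = (e v).2) := by
      rw [← Prod.ext_iff, e.injective.eq_iff]
    simp only [SimpleGraph.boxProd_adj, SimpleGraph.circulantGraph, SimpleGraph.fromRel_adj, h,
      map_sub, Prod.fst_sub, Prod.snd_sub, sub_eq_zero, hne, AddEquiv.toEquiv_eq_coe,
      AddEquiv.coe_toEquiv, eq_comm (a := (e v).1), eq_comm (a := (e v).2)]
    tauto

/-- For coprime `p` and `q`, the group `ZMod (p * q)` is the direct sum of the multiples of `q`,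
a copy of `ZMod p`, and the multiples of `p`, a copy of `ZMod q`. -/
theorem ZMod.exists_addEquiv_prod_of_coprime {p q : ℕ} (h : Nat.Coprime p q) :
    ∃ e : ZMod (p * q) ≃+ ZMod p × ZMod q,
      (∀ k : ℕ, e ((q * k : ℕ) : ZMod (p * q)) = ((k : ZMod p), 0)) ∧
      ∀ k : ℕ, e ((p * k : ℕ) : ZMod (p * q)) = (0, (k : ZMod q)) := by
  let f := (ZMod.chineseRemainder h).toAddEquiv.trans
    ((DistribMulAction.toAddEquiv (ZMod p) (ZMod.unitOfCoprime q h.symm)⁻¹).prodCongr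
      (DistribMulAction.toAddEquiv (ZMod q) (ZMod.unitOfCoprime p h)⁻¹))
  have hf (k : ℕ) : f k = ((ZMod.unitOfCoprime q h.symm)⁻¹ • (k : ZMod p),
      (ZMod.unitOfCoprime p h)⁻¹ • (k : ZMod q)) := by
    have hk : ZMod.chineseRemainder h k = ((k : ZMod p), (k : ZMod q)) := by
      rw [map_natCast]
      rfl
    change Prod.map _ _ (ZMod.chineseRemainder h k) = _
    rw [hk]
    rfl
  refine ⟨f, fun k => ?_, fun k => ?_⟩ <;> rw [hf, Prod.mk.injEq, inv_smul_eq_iff, inv_smul_eq_iff]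
    <;> simp [Units.smul_def]

theorem stmt16 (n a b p q : ℕ) (hn : 2 ≤ n) (hneven : Even n) (haeven : Even a) (hbodd : Odd b)
    (ha0 : 0 < a) (han : a < n) (hb0 : 0 < b) (hbn : b < n) (hab : a ≠ b)
    (hp : 2 < p) (hq1 : 1 < q) (hqn : q < n)
    (hpa : p ∣ a) (hqb : q ∣ b) (hpq : p * q = 2*n) (hcop : Nat.gcd p q = 1) :
    Even p ∧
      Nonempty
        ((SimpleGraph.circulantGraph {((a : ℕ) : ZMod (2*n)), ((b : ℕ) : ZMod (2*n)), ((n : ℕ) : ZMod (2*n))}) ≃g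
          (SimpleGraph.boxProd
            (SimpleGraph.circulantGraph {((p/2 : ℕ) : ZMod p), ((b/q : ℕ) : ZMod p)})
            (SimpleGraph.circulantGraph {((a/p : ℕ) : ZMod q)}))) := by
  have hqodd : Odd q := hbodd.of_dvd_nat hqb
  have hpeven : Even p :=
    (Nat.even_mul.1 (hpq ▸ even_two_mul n)).resolve_right (Nat.not_even_iff_odd.2 hqodd)
  refine ⟨hpeven, ?_⟩
  obtain ⟨r, rfl⟩ := hpeven.two_dvd
  obtain ⟨c, rfl⟩ := hpa
  obtain ⟨d, rfl⟩ := hqb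
  obtain rfl : n = q * r := by linarith
  rw [← hpq, Nat.mul_div_cancel_left _ (by omega), Nat.mul_div_cancel_left _ (by omega),
    Nat.mul_div_cancel_left _ (by omega)]
  obtain ⟨e, hleft, hright⟩ := ZMod.exists_addEquiv_prod_of_coprime hcop
  refine ⟨SimpleGraph.circulantGraphIsoBoxProd_s16 e fun g => ?_⟩
  simp only [Set.mem_insert_iff, Set.mem_singleton_iff]
  rw [← e.injective.eq_iff, ← e.injective.eq_iff (b := ((q * d : ℕ) : ZMod (2 * r * q))),
    ← e.injective.eq_iff (b := ((q * r : ℕ) : ZMod (2 * r * q))), hleft, hleft, hright]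
  simp only [Prod.ext_iff]
  tauto
end

section
/- Let n ≥ 3 and let x be an integer with 1 < x < n. If n ≡ 0 (mod 3), x ≡ 0 (mod 3), and n ≤ 2x, then the 5-regular circulant graph C_{2n}(x,1,n) is word-representable. -/
/-- The edges of `G`, oriented from smaller to larger rank. -/
def OrientedAdj {V : Type*} (G : SimpleGraph V) (r : V → ℕ) (a b : V) : Prop :=
  G.Adj a b ∧ r a < r b

/-- An acyclic orientation is semi-transitive if every vertex on a directed path parallel to
an edge is joined to both ends of that edge. -/
def IsSemiTransitive {V : Type*} (D : V → V → Prop) : Prop :=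
  ∀ a v b, D a b → Relation.TransGen D a v → Relation.TransGen D v b → D a v ∧ D v b

/-- The possible positions of a vertex relative to a fixed vertex of an acyclic digraph. -/
inductive Region
  | center | inNbr | ancestor | outNbr | descendant | other
  deriving DecidableEq

open Classical in
/-- The position of `u` relative to `v`; `ancestor` and `descendant` exclude neighbours. -/
noncomputable def region {V : Type*} (D : V → V → Prop) (v u : V) : Region :=
  if u = v then .center
  else if D u v then .inNbr
  else if Relation.TransGen D u v then .ancestor
  else if D v u then .outNbr
  else if Relation.TransGen D v u then .descendant
  else .other

/-- The order in which the regions are traversed; every region occurs twice. -/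
def regionOrder : List Region :=
  [.ancestor, .inNbr, .other, .ancestor, .center, .outNbr,
    .inNbr, .center, .descendant, .other, .outNbr, .descendant]

/-- The 2-uniform word which lists the regions around `v` in `regionOrder`, each in the order
given by `L`. -/
noncomputable def regionWord {V : Type*} (D : V → V → Prop) (L : List V) (v : V) : List V :=
  regionOrder.flatMap fun c => L.filter fun u => decide (region D v u = c)

theorem filter_regionWord {V : Type*} (D : V → V → Prop) (L : List V) (v : V) (p : V → Bool) :
    (regionWord D L v).filter p = regionWord D (L.filter p) v := by
  simp only [regionWord, List.filter_flatMap, List.filter_filter, Bool.and_comm]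

theorem regionWord_pair_of_adj {V : Type*} {G : SimpleGraph V} {r : V → ℕ}
    (h : IsSemiTransitive (OrientedAdj G r)) {i j : V} (hij : OrientedAdj G r i j) (v : V) :
    regionWord (OrientedAdj G r) [i, j] v = [i, j, i, j] := by
  set D := OrientedAdj G r
  have rank_lt : ∀ {a b}, Relation.TransGen D a b → r a < r b := by
    intro a b hab
    induction hab with
    | single h => exact h.2
    | tail _ h ih => exact ih.trans h.2
  have irrefl : ∀ a, ¬ Relation.TransGen D a a := fun a ha => (rank_lt ha).false
  have hne : i ≠ j := fun e => by subst e; exact hij.2.false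
  have single : ∀ {a b}, D a b → Relation.TransGen D a b := .single
  have trans : ∀ {a b c}, Relation.TransGen D a b → Relation.TransGen D b c →
    Relation.TransGen D a c := .trans
  have head := h i v j hij
  have enter : D i v → Relation.TransGen D j v → D j v := fun h1 h2 => (h i j v h1 (single hij) h2).2
  have leave : D v j → Relation.TransGen D v i → D v i := fun h1 h2 => (h v i j h1 h2 (single hij)).1
  rcases hi : region D v i <;> rcases hj : region D v j <;>
    first
    | (simp [regionWord, regionOrder, hi, hj]; done)
    | (exfalso
       unfold region at hi hj
       grind)

theorem not_isChain_regionWord_pair {V : Type*} {G : SimpleGraph V} {r : V → ℕ} {u v : V}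
    (huv : u ≠ v) (h : ¬ G.Adj u v) :
    ¬ (regionWord (OrientedAdj G r) [u, v] v).IsChain (· ≠ ·) := by
  have hv : region (OrientedAdj G r) v v = .center := by simp [region]
  have hin : region (OrientedAdj G r) v u ≠ .inNbr := by
    unfold region OrientedAdj; grind
  have hout : region (OrientedAdj G r) v u ≠ .outNbr := by
    unfold region OrientedAdj; grind [SimpleGraph.adj_comm]
  have hc : region (OrientedAdj G r) v u ≠ .center := by
    unfold region; grind
  rcases hu : region (OrientedAdj G r) v u <;>
    simp_all [regionWord, regionOrder]

theorem filter_pair_of_pairwise {V : Type*} [DecidableEq V] {r : V → ℕ} {L : List V}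
    (hL : L.Pairwise (r · < r ·)) {i j : V} (hi : i ∈ L) (hj : j ∈ L) (hij : r i < r j) :
    L.filter (fun z => decide (z = i ∨ z = j)) = [i, j] := by
  have hne : i ≠ j := fun e => by subst e; exact hij.false
  have nodup : L.Nodup := hL.imp fun h e => by subst e; exact h.false
  refine List.Perm.eq_of_pairwise (le := (r · < r ·)) (fun a b _ _ h1 h2 => (h1.asymm h2).elim)
    (hL.filter _) (by simpa using hij) ?_
  rw [List.perm_ext_iff_of_nodup (nodup.filter _) (by simpa using hne)]
  grind

theorem exists_list_pairwise_rank_lt {V : Type*} [Fintype V] {r : V → ℕ}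
    (hr : Function.Injective r) : ∃ L : List V, (∀ v, v ∈ L) ∧ L.Pairwise (r · < r ·) := by
  let := LinearOrder.lift' r hr
  exact ⟨Finset.univ.sort (· ≤ ·), by simp, Finset.sortedLT_sort _ |>.pairwise⟩

/-- A graph with a semi-transitive orientation is word-representable. -/
theorem wordRepresentable_of_isSemiTransitive {V : Type*} [DecidableEq V] [Fintype V]
    {G : SimpleGraph V} {r : V → ℕ} (hr : Function.Injective r)
    (h : IsSemiTransitive (OrientedAdj G r)) : WordRepresentable G := by
  obtain ⟨L, hmem, hL⟩ := exists_list_pairwise_rank_lt hr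
  set D := OrientedAdj G r
  have filter_word : ∀ {a b}, r a < r b →
      (L.flatMap (regionWord D L)).filter (fun z => decide (z = a ∨ z = b)) =
        L.flatMap (regionWord D [a, b]) := by
    intro a b hab
    simp only [List.filter_flatMap, filter_regionWord,
      filter_pair_of_pairwise hL (hmem a) (hmem b) hab]
  have main : ∀ a b, r a < r b → (G.Adj a b ↔ Alternate (L.flatMap (regionWord D L)) a b) := by
    intro a b hab
    have hne : a ≠ b := fun e => by subst e; exact hab.false
    rw [Alternate, filter_word hab]
    constructor
    · intro hadj
      have : regionWord D [a, b] = fun _ => [a, b, a, b] :=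
        funext (regionWord_pair_of_adj h ⟨hadj, hab⟩)
      rw [this]
      change List.IsChain _ _
      clear * - hne
      induction L with
      | nil => simp
      | cons c L ih =>
        cases L <;> simp_all [List.isChain_cons_cons, hne.symm]
    · intro hchain
      by_contra hadj
      exact not_isChain_regionWord_pair hne hadj
        (List.IsChain.infix hchain (List.infix_flatMap_of_mem (hmem b) _))
  refine ⟨L.flatMap (regionWord D L), fun v => ?_, fun a b hab => ?_⟩
  · simp only [List.mem_flatMap]
    refine ⟨v, hmem v, ?_⟩
    simp [regionWord, regionOrder, hmem, region]
  · rcases lt_or_gt_of_ne (hr.ne hab) with hlt | hlt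
    · exact main a b hlt
    · rw [G.adj_comm, main b a hlt]
      simp only [Alternate, or_comm]

/-- The arcs of a semi-transitive orientation of the circulant graph with jumps `1`, `x`, `n`,
on representatives in `{0, …, 2n - 1}`. -/
def CircArc (n x u w : ℕ) : Prop :=
  (u % 3 = w % 3 ∧ (w = u + x ∨ w = u + n ∨ w + x = u + 2 * n)) ∨
  (u % 3 ≠ 0 ∧ w = u + 1) ∨ (u % 3 = 1 ∧ w + 1 = u) ∨ (u = 0 ∧ w + 1 = 2 * n)

/-- A transitive relation containing `CircArc`. -/
def CircReach (n x u w : ℕ) : Prop :=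
  (u ≤ 1 ∧ w + 1 = 2 * n) ∨
  (u % 3 = w % 3 ∧ (w = u + x ∨ w = u + n ∨ w + x = u + 2 * n ∨ u + 2 * x ≤ w)) ∨
  (u % 3 = 1 ∧ w % 3 = 2 ∧ (w = u + 1 ∨ u + 1 + x ≤ w)) ∨
  (u % 3 = 2 ∧ w % 3 = 0 ∧ (w = u + 1 ∨ u + 1 + x ≤ w)) ∨
  (u % 3 = 1 ∧ w % 3 = 0 ∧ (w + 1 = u ∨ u + 2 ≤ w))

/-- A rank function inducing the orientation `CircArc`. -/
def circRank (n v : ℕ) : ℕ :=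
  if v = 1 then 0 else if v = 0 then 1 else 2 + (v + 2) % 3 * (2 * n) + v

theorem CircArc.circReach {n x u w : ℕ} (h : CircArc n x u w) : CircReach n x u w := by
  unfold CircReach
  rcases h with ⟨e, h⟩ | ⟨e, h⟩ | ⟨e, h⟩ | ⟨e, h⟩
  · exact .inr (.inl (by omega))
  · rcases (by omega : u % 3 = 1 ∨ u % 3 = 2) with e | e
    · exact .inr (.inr (.inl (by omega)))
    · exact .inr (.inr (.inr (.inl (by omega))))
  · exact .inr (.inr (.inr (.inr (by omega))))
  · exact .inl (by omega)

set_option maxHeartbeats 2000000 in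
theorem CircReach.trans {n x u v w : ℕ} (hx1 : 1 < x) (hxn : x < n)
    (h0 : n % 3 = 0) (h1 : x % 3 = 0) (h2 : n ≤ 2 * x)
    (hu : u < 2 * n) (hv : v < 2 * n) (hw : w < 2 * n)
    (huv : CircReach n x u v) (hvw : CircReach n x v w) : CircReach n x u w := by
  have hu3 : u % 3 = 0 ∨ u % 3 = 1 ∨ u % 3 = 2 := by omega
  have hv3 : v % 3 = 0 ∨ v % 3 = 1 ∨ v % 3 = 2 := by omega
  have hw3 : w % 3 = 0 ∨ w % 3 = 1 ∨ w % 3 = 2 := by omega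
  unfold CircReach at *
  rcases hu3 with e | e | e <;> rcases hv3 with e' | e' | e' <;> rcases hw3 with e'' | e'' | e'' <;>
    simp [e, e', e''] at huv hvw ⊢ <;> omega

set_option maxHeartbeats 2000000 in
theorem CircArc.of_circReach {n x a v b : ℕ} (hx1 : 1 < x) (hxn : x < n)
    (h0 : n % 3 = 0) (h1 : x % 3 = 0) (h2 : n ≤ 2 * x)
    (ha : a < 2 * n) (hv : v < 2 * n) (hb : b < 2 * n) (hab : CircArc n x a b)
    (hav : CircReach n x a v) (hvb : CircReach n x v b) : CircArc n x a v ∧ CircArc n x v b := by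
  have ha3 : a % 3 = 0 ∨ a % 3 = 1 ∨ a % 3 = 2 := by omega
  have hv3 : v % 3 = 0 ∨ v % 3 = 1 ∨ v % 3 = 2 := by omega
  have hb3 : b % 3 = 0 ∨ b % 3 = 1 ∨ b % 3 = 2 := by omega
  unfold CircReach CircArc at *
  rcases ha3 with e | e | e <;> rcases hv3 with e' | e' | e' <;> rcases hb3 with e'' | e'' | e'' <;>
    simp [e, e', e''] at hab hav hvb ⊢ <;> omega

set_option maxHeartbeats 2000000 in
theorem circRank_injOn {n u v : ℕ} (hu : u < 2 * n) (hv : v < 2 * n)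
    (h : circRank n u = circRank n v) : u = v := by
  have hu3 : (u + 2) % 3 = 0 ∨ (u + 2) % 3 = 1 ∨ (u + 2) % 3 = 2 := by omega
  have hv3 : (v + 2) % 3 = 0 ∨ (v + 2) % 3 = 1 ∨ (v + 2) % 3 = 2 := by omega
  unfold circRank at h
  split_ifs at h <;> rcases hu3 with e | e | e <;> rcases hv3 with e' | e' | e' <;>
    (try simp only [e, e'] at h) <;> omega

set_option maxHeartbeats 2000000 in
theorem circArc_iff {n x u w : ℕ} (hx1 : 1 < x) (hxn : x < n)
    (h0 : n % 3 = 0) (h1 : x % 3 = 0) (hu : u < 2 * n) (hw : w < 2 * n) :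
    ((w = u + 1 ∨ w = u + x ∨ w = u + n ∨ w + x = u + 2 * n ∨ w + 1 = u + 2 * n ∨
      u = w + 1 ∨ u = w + x ∨ u = w + n ∨ u + x = w + 2 * n ∨ u + 1 = w + 2 * n) ∧
      circRank n u < circRank n w) ↔ CircArc n x u w := by
  have residues : ∀ k : ℕ, (k % 3 = 0 ∧ (k + 2) % 3 = 2) ∨ (k % 3 = 1 ∧ (k + 2) % 3 = 0) ∨
      (k % 3 = 2 ∧ (k + 2) % 3 = 1) := by omega
  unfold circRank CircArc
  rcases residues u with ⟨e, f⟩ | ⟨e, f⟩ | ⟨e, f⟩ <;>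
    rcases residues w with ⟨e', f'⟩ | ⟨e', f'⟩ | ⟨e', f'⟩ <;>
    simp only [e, e', f, f'] <;> clear f f' <;> split_ifs <;> simp <;> omega

theorem zmod_sub_eq_natCast_iff {m d : ℕ} [NeZero m] (hd : d < m) (a b : ZMod m) :
    a - b = (d : ZMod m) ↔ a.val = b.val + d ∨ a.val + m = b.val + d := by
  have ha := a.val_lt
  have hb := b.val_lt
  have hval : (d : ZMod m).val = d := ZMod.val_natCast_of_lt hd
  rw [sub_eq_iff_eq_add, ← (ZMod.val_injective m).eq_iff, ZMod.val_add, hval]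
  rcases lt_or_ge (d + b.val) m with hlt | hge
  · rw [Nat.mod_eq_of_lt hlt]; omega
  · rw [Nat.mod_eq_sub_mod hge, Nat.mod_eq_of_lt (by omega)]; omega

theorem orientedAdj_circulantGraph_iff {n x : ℕ} (hx1 : 1 < x) (hxn : x < n)
    (h0 : n % 3 = 0) (h1 : x % 3 = 0) (u w : ZMod (2 * n)) :
    OrientedAdj (SimpleGraph.circulantGraph
      {((1 : ℕ) : ZMod (2*n)), ((x : ℕ) : ZMod (2*n)), ((n : ℕ) : ZMod (2*n))})
      (fun v => circRank n v.val) u w ↔ CircArc n x u.val w.val := by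
  have : NeZero (2 * n) := ⟨by omega⟩
  have hu := u.val_lt
  have hw := w.val_lt
  rw [← circArc_iff hx1 hxn h0 h1 hu hw, OrientedAdj, SimpleGraph.circulantGraph]
  refine and_congr_left fun hlt => ?_
  have hne : u ≠ w := fun e => by subst e; exact hlt.false
  simp only [SimpleGraph.fromRel_adj, Set.mem_insert_iff, Set.mem_singleton_iff, ne_eq, hne,
    not_false_eq_true, true_and]
  rw [zmod_sub_eq_natCast_iff (by omega), zmod_sub_eq_natCast_iff (by omega),
    zmod_sub_eq_natCast_iff (by omega), zmod_sub_eq_natCast_iff (by omega),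
    zmod_sub_eq_natCast_iff (by omega), zmod_sub_eq_natCast_iff (by omega)]
  omega

theorem stmt17 (n x : ℕ) (hn : 3 ≤ n) (hx1 : 1 < x) (hxn : x < n)
    (h0 : n % 3 = 0) (h1 : x % 3 = 0) (h2 : n ≤ 2*x) :
    WordRepresentable (SimpleGraph.circulantGraph {((1 : ℕ) : ZMod (2*n)), ((x : ℕ) : ZMod (2*n)), ((n : ℕ) : ZMod (2*n))}) := by
  have : NeZero (2 * n) := ⟨by omega⟩
  refine wordRepresentable_of_isSemiTransitive (r := fun v => circRank n v.val)
    (fun a b hab => ZMod.val_injective _ (circRank_injOn a.val_lt b.val_lt hab)) ?_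
  have reach : ∀ {a b : ZMod (2 * n)},
      Relation.TransGen (OrientedAdj (SimpleGraph.circulantGraph
        {((1 : ℕ) : ZMod (2*n)), ((x : ℕ) : ZMod (2*n)), ((n : ℕ) : ZMod (2*n))})
        (fun v => circRank n v.val)) a b → CircReach n x a.val b.val := by
    intro a b hab
    induction hab with
    | single h =>
      exact ((orientedAdj_circulantGraph_iff hx1 hxn h0 h1 _ _).1 h).circReach
    | tail _ h ih =>
      exact ih.trans hx1 hxn h0 h1 h2 (ZMod.val_lt _) (ZMod.val_lt _) (ZMod.val_lt _)
        (((orientedAdj_circulantGraph_iff hx1 hxn h0 h1 _ _).1 h).circReach)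
  intro a v b hab hav hvb
  rw [orientedAdj_circulantGraph_iff hx1 hxn h0 h1] at hab ⊢
  rw [orientedAdj_circulantGraph_iff hx1 hxn h0 h1]
  exact hab.of_circReach hx1 hxn h0 h1 h2 a.val_lt v.val_lt b.val_lt (reach hav) (reach hvb)
end

section
/- Let n ≥ 3 and let x be an integer with 1 < x < n. If n ≡ 2 (mod 3), x ≡ 1 (mod 3), and 3x ≤ 2n, then the 5-regular circulant graph C_{2n}(x,1,n) is word-representable. -/
section SemiTransitive

variable {V : Type*}

open Classical in
/-- The position of a vertex `u` relative to a vertex `v` in the acyclic orientation `D`: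
`0` for a non-adjacent ancestor, `1` for an in-neighbour, `2` for an incomparable vertex,
`3` for `v` itself, `4` for an out-neighbour and `5` for a non-adjacent descendant. -/
noncomputable def relKind (D : V → V → Prop) (v u : V) : ℕ :=
  if u = v then 3
  else if D u v then 1
  else if D v u then 4
  else if Relation.TransGen D u v then 0
  else if Relation.TransGen D v u then 5
  else 2

/-- The pattern of kinds of the `2`-uniform word that separates a vertex from its
non-neighbours. -/
def kindPattern : List ℕ := [0, 1, 2, 0, 3, 4, 1, 3, 5, 2, 4, 5]

/-- The `2`-uniform word that keeps all arcs of `D` alternating and separates `v` from its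
non-neighbours; `L` lists the vertices in a topological order. -/
noncomputable def separatingWord (D : V → V → Prop) (L : List V) (v : V) : List V :=
  kindPattern.flatMap fun j => L.filter fun u => relKind D v u = j

theorem filter_pair_of_nodup [DecidableEq V] {L : List V} (hL : L.Nodup) {x y : V}
    (hxy : x ≠ y) (hx : x ∈ L) (hy : y ∈ L) :
    L.filter (fun z => decide (z = x ∨ z = y)) = [x, y] ∨
      L.filter (fun z => decide (z = x ∨ z = y)) = [y, x] := by
  have hp : (L.filter (fun z => decide (z = x ∨ z = y))).Perm [x, y] := by
    rw [List.perm_ext_iff_of_nodup (hL.filter _) (by simp [hxy])]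
    intro a
    simp only [List.mem_filter, decide_eq_true_eq, List.mem_cons, List.not_mem_nil, or_false]
    constructor
    · exact fun h => h.2
    · rintro (rfl | rfl) <;> simp [*]
  rcases h : L.filter (fun z => decide (z = x ∨ z = y)) with _ | ⟨a, _ | ⟨b, _ | ⟨c, l⟩⟩⟩
  · simp only [h] at hp
    simpa using hp.length_eq
  · simp only [h] at hp
    simpa using hp.length_eq
  · rw [h] at hp
    have ha : a ∈ [x, y] := hp.subset (by simp)
    have hb : b ∈ [x, y] := hp.subset (by simp)
    have hn : [a, b].Nodup := hp.nodup_iff.2 (by simp [hxy])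
    simp only [List.mem_cons, List.not_mem_nil, or_false] at ha hb
    rcases ha with rfl | rfl <;> rcases hb with rfl | rfl <;> simp at hn ⊢
  · simp only [h] at hp
    simpa using hp.length_eq

theorem filter_separatingWord (D : V → V → Prop) (L : List V) (v : V) (p : V → Bool) :
    (separatingWord D L v).filter p =
      kindPattern.flatMap fun j => (L.filter p).filter fun u => relKind D v u = j := by
  simp only [separatingWord, List.filter_flatMap, List.filter_filter, Bool.and_comm]

theorem flatMap_relKind_of_arc {D : V → V → Prop} {f : V → ℕ} (hf : ∀ u v, D u v → f u < f v)
    (hS : ∀ u v y, D u y → Relation.TransGen D u v → Relation.TransGen D v y → D u v ∧ D v y)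
    {x y : V} (hxy : D x y) (v : V) :
    (kindPattern.flatMap fun j => [x, y].filter fun u => relKind D v u = j) = [x, y, x, y] := by
  have hlt : ∀ a b, Relation.TransGen D a b → f a < f b := by
    intro a b h
    induction h with
    | single h => exact hf _ _ h
    | tail _ h ih => exact ih.trans (hf _ _ h)
  have hne : ∀ a b, D a b → ¬ Relation.TransGen D b a := fun a b h h' =>
    lt_asymm (hf _ _ h) (hlt _ _ h')
  have hirr : ∀ a, ¬ D a a := fun a h => lt_irrefl _ (hf _ _ h)
  have hasymm : ∀ a b, D a b → ¬ D b a := fun a b h h' => lt_asymm (hf _ _ h) (hf _ _ h')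
  have hs : ∀ a b, D a b → Relation.TransGen D a b := fun _ _ => .single
  have hS₁ := hS x v y hxy
  have hS₂ := hS x y v
  have hS₃ := hS v x y
  have hxv : Relation.TransGen D y v → Relation.TransGen D x v := .head hxy
  have hvy : Relation.TransGen D v x → Relation.TransGen D v y := fun h => h.tail hxy
  have hcyc : Relation.TransGen D v x → ¬ Relation.TransGen D y v := fun h h' =>
    lt_asymm (hf _ _ hxy) ((hlt _ _ h').trans (hlt _ _ h))
  have key : (relKind D v x, relKind D v y) ∈
      [(0, 0), (0, 1), (0, 2), (1, 1), (1, 2), (1, 3), (1, 4), (2, 2), (2, 4), (2, 5), (3, 4),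
        (4, 4), (4, 5), (5, 5)] := by
    unfold relKind
    split_ifs <;> simp <;> grind
  simp only [List.mem_cons, Prod.mk.injEq, List.not_mem_nil, or_false] at key
  rcases key with h | h | h | h | h | h | h | h | h | h | h | h | h | h <;>
    simp [kindPattern, List.filter, h.1, h.2]

theorem not_isChain_flatMap_relKind {D : V → V → Prop} {x y : V} (hne : x ≠ y)
    (hxy : ¬ D x y) (hyx : ¬ D y x) {l : List V} (hl : l = [x, y] ∨ l = [y, x]) :
    ¬ (kindPattern.flatMap fun j => l.filter fun u => relKind D x u = j).IsChain (· ≠ ·) := by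
  have hx : relKind D x x = 3 := by simp [relKind]
  have hy : relKind D x y = 0 ∨ relKind D x y = 2 ∨ relKind D x y = 5 := by
    unfold relKind
    split_ifs <;> simp_all
  rcases hl with rfl | rfl <;> rcases hy with hy | hy | hy <;>
    simp [kindPattern, List.filter, hx, hy]

theorem isChain_flatMap_const_pair {x y : V} (hxy : x ≠ y) (l : List V) :
    (l.flatMap fun _ => [x, y, x, y]).IsChain (· ≠ ·) := by
  induction l with
  | nil => simp
  | cons a l ih =>
    cases l with
    | nil => simp [hxy, hxy.symm]
    | cons b l =>
      simp only [List.flatMap_cons, List.cons_append, List.nil_append] at ih ⊢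
      simp only [List.isChain_cons_cons] at ih ⊢
      exact ⟨hxy, hxy.symm, hxy, hxy.symm, ih⟩

variable [DecidableEq V]

theorem alternate_comm {w : List V} {x y : V} : Alternate w x y ↔ Alternate w y x := by
  simp only [Alternate, or_comm]

/-- A graph with a semi-transitive orientation is word-representable. -/
theorem wordRepresentable_of_semiTransitive [Fintype V] {G : SimpleGraph V} {D : V → V → Prop}
    (hD : ∀ u v, G.Adj u v ↔ D u v ∨ D v u) {f : V → ℕ} (hf : ∀ u v, D u v → f u < f v)
    (hS : ∀ u v y, D u y → Relation.TransGen D u v → Relation.TransGen D v y → D u v ∧ D v y) :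
    WordRepresentable G := by
  obtain ⟨L, hnd, hmem, hsort⟩ : ∃ L : List V, L.Nodup ∧ (∀ v, v ∈ L) ∧
      L.Pairwise (fun a b => f a ≤ f b) := by
    have : Std.Total (fun a b : V => f a ≤ f b) := ⟨fun a b => le_total _ _⟩
    have : IsTrans V (fun a b : V => f a ≤ f b) := ⟨fun a b c => le_trans⟩
    refine ⟨(Finset.univ : Finset V).toList.insertionSort (fun a b => f a ≤ f b), ?_, ?_, ?_⟩
    · exact (List.perm_insertionSort _ _).nodup_iff.2 (Finset.nodup_toList _)
    · intro v
      simp [List.mem_insertionSort]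
    · exact List.pairwise_insertionSort _ _
  have arc : ∀ x y, D x y → Alternate (L.flatMap (separatingWord D L)) x y := by
    intro x y hxy
    have hne : x ≠ y := by
      rintro rfl
      exact lt_irrefl _ (hf _ _ hxy)
    have hL : L.filter (fun z => decide (z = x ∨ z = y)) = [x, y] := by
      refine (filter_pair_of_nodup hnd hne (hmem x) (hmem y)).resolve_right fun h => ?_
      have := hsort.filter (fun z => decide (z = x ∨ z = y))
      rw [h] at this
      have h' := hf _ _ hxy
      simp at this
      omega
    have : (L.flatMap (separatingWord D L)).filter (fun z => decide (z = x ∨ z = y)) =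
        L.flatMap fun _ => [x, y, x, y] := by
      rw [List.filter_flatMap]
      congr 1
      funext v
      rw [filter_separatingWord, hL, flatMap_relKind_of_arc hf hS hxy v]
    rw [Alternate, this]
    exact isChain_flatMap_const_pair hne L
  refine ⟨L.flatMap (separatingWord D L), fun v => ?_, fun x y hne => ?_⟩
  · refine List.mem_flatMap.2 ⟨v, hmem v, List.mem_flatMap.2 ⟨3, by simp [kindPattern], ?_⟩⟩
    simp [hmem, relKind]
  · constructor
    · intro h
      rcases (hD x y).1 h with h | h
      · exact arc x y h
      · exact alternate_comm.1 (arc y x h)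
    · intro h
      by_contra hadj
      rw [hD, not_or] at hadj
      have hsub : separatingWord D L x <:+: L.flatMap (separatingWord D L) := by
        obtain ⟨s, t, hst⟩ := List.append_of_mem (hmem x)
        refine ⟨s.flatMap (separatingWord D L), t.flatMap (separatingWord D L), ?_⟩
        have := congrArg (List.flatMap (separatingWord D L)) hst
        simp [this]
      have hchain := List.IsChain.infix h (hsub.filter _)
      rw [filter_separatingWord] at hchain
      exact not_isChain_flatMap_relKind hne hadj.1 hadj.2
        (filter_pair_of_nodup hnd hne (hmem x) (hmem y)) hchain

/-- A properly `4`-coloured graph in which every `4`-cycle coloured `0, 1, 2, 3` in this cyclic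
order spans a clique is word-representable. -/
theorem wordRepresentable_of_fourColoring [Fintype V] {G : SimpleGraph V} (f : V → ℕ)
    (hlt : ∀ v, f v < 4) (hf : ∀ u v, G.Adj u v → f u ≠ f v)
    (hcycle : ∀ a b c d, G.Adj a b → G.Adj b c → G.Adj c d → G.Adj d a →
      f a = 0 → f b = 1 → f c = 2 → f d = 3 → G.Adj a c ∧ G.Adj b d) :
    WordRepresentable G := by
  let D : V → V → Prop := fun u v => G.Adj u v ∧ f u < f v
  have htrans : ∀ u v, Relation.TransGen D u v → f u < f v := by
    intro a b h
    induction h with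
    | single h => exact h.2
    | tail _ h ih => exact ih.trans h.2
  refine wordRepresentable_of_semiTransitive (D := D) (f := f) ?_ (fun u v h => h.2) ?_
  · intro u v
    constructor
    · intro h
      rcases lt_or_gt_of_ne (hf u v h) with h' | h'
      · exact Or.inl ⟨h, h'⟩
      · exact Or.inr ⟨h.symm, h'⟩
    · rintro (h | h)
      · exact h.1
      · exact h.1.symm
  · intro u v y huy huv hvy
    rcases Relation.TransGen.head'_iff.1 huv with ⟨p, hup, hpv⟩
    rcases Relation.TransGen.head'_iff.1 hvy with ⟨q, hvq, hqy⟩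
    rcases Relation.reflTransGen_iff_eq_or_transGen.1 hpv with rfl | hpv
    · rcases Relation.reflTransGen_iff_eq_or_transGen.1 hqy with rfl | hqy
      · exact ⟨hup, hvq⟩
      · have h₁ := hup.2
        have h₂ := hvq.2
        have h₃ := htrans _ _ hqy
        have h₄ := hlt y
        rcases Relation.TransGen.head'_iff.1 hqy with ⟨r, hqr, hry⟩
        rcases Relation.reflTransGen_iff_eq_or_transGen.1 hry with rfl | hry
        · have := hcycle u v q y hup.1 hvq.1 hqr.1 huy.1.symm (by omega) (by omega) (by omega)
            (by omega)
          exact ⟨hup, this.2, by omega⟩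
        · have h₅ := hqr.2
          have h₆ := htrans _ _ hry
          omega
    · have h₁ := hup.2
      have h₂ := htrans _ _ hpv
      have h₃ := hvq.2
      have h₄ := hlt y
      have h₅ := hlt q
      rcases Relation.reflTransGen_iff_eq_or_transGen.1 hqy with rfl | hqy
      · rcases Relation.TransGen.head'_iff.1 hpv with ⟨r, hpr, hrv⟩
        rcases Relation.reflTransGen_iff_eq_or_transGen.1 hrv with rfl | hrv
        · have := hcycle u p v y hup.1 hpr.1 hvq.1 huy.1.symm (by omega) (by omega) (by omega)
            (by omega)
          exact ⟨⟨this.1, by omega⟩, hvq⟩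
        · have h₆ := hpr.2
          have h₇ := htrans _ _ hrv
          omega
      · have h₆ := htrans _ _ hqy
        omega

end SemiTransitive

/-- A multiplier under which all three jumps land in the middle third of the cycle. -/
theorem exists_odd_multiplier {n x : ℕ} (hx1 : 1 < x) (h0 : n % 3 = 2) (h1 : x % 3 = 1)
    (h2 : 3 * x ≤ 2 * n) (hne : n ≠ 2 * x) :
    ∃ t, t % 2 = 1 ∧ 2 * n ≤ 3 * (t % (2 * n)) ∧ 3 * (t % (2 * n)) ≤ 2 * (2 * n) ∧
      2 * n ≤ 3 * (t * x % (2 * n)) ∧ 3 * (t * x % (2 * n)) ≤ 2 * (2 * n) := by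
  have ceil : ∀ a d : ℕ, 0 < d → ∃ m, a ≤ d * m ∧ d * m < a + d := by
    intro a d hd
    refine ⟨(a + d - 1) / d, ?_, ?_⟩
    · have := Nat.div_add_mod (a + d - 1) d
      have := Nat.mod_lt (a + d - 1) hd
      omega
    · have := Nat.mul_div_le (a + d - 1) d
      omega
  obtain ⟨k, j, hk6, hkN, hlo, hhi⟩ : ∃ k j, k % 6 = 5 ∧ k ≤ 2 * n ∧ 3 * j * (2 * n) ≤ k * x ∧
      k * x ≤ 3 * j * (2 * n) + 2 * n := by
    by_cases h5 : 5 * x ≤ 2 * n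
    · exact ⟨5, 0, by omega, by omega, by omega, by omega⟩
    by_cases h11 : 6 * n ≤ 11 * x
    · exact ⟨11, 1, by omega, by omega, by omega, by omega⟩
    rcases lt_or_gt_of_ne hne with h | h
    · obtain ⟨d, hd⟩ : ∃ d, 2 * x = n + 3 * d := ⟨(2 * x - n) / 3, by omega⟩
      obtain ⟨m, hm₁, hm₂⟩ := ceil (6 * n - 11 * x) (18 * d) (by omega)
      have hmd : m * (2 * x) = m * n + 3 * (d * m) := by rw [hd]; ring
      have hdm : m ≤ d * m := Nat.le_mul_of_pos_left m (by omega)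
      rw [mul_assoc] at hm₁ hm₂
      refine ⟨12 * m + 11, m + 1, by omega, by omega, ?_, ?_⟩ <;> ring_nf at * <;> omega
    · obtain ⟨d, hd⟩ : ∃ d, n = 2 * x + 3 * d := ⟨(n - 2 * x) / 3, by omega⟩
      obtain ⟨m, hm₁, hm₂⟩ := ceil (5 * x - 2 * n) (18 * d) (by omega)
      have hmd : m * n = m * (2 * x) + 3 * (d * m) := by rw [hd]; ring
      have hdm : m ≤ d * m := Nat.le_mul_of_pos_left m (by omega)
      rw [mul_assoc] at hm₁ hm₂
      refine ⟨12 * m + 5, m, by omega, by omega, ?_, ?_⟩ <;> ring_nf at * <;> omega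
  obtain ⟨y, rfl⟩ : ∃ y, x = 3 * y + 1 := ⟨x / 3, by omega⟩
  obtain ⟨t, ht⟩ : ∃ t, 3 * t = 2 * n + k := ⟨(2 * n + k) / 3, by omega⟩
  obtain ⟨r, hr⟩ := Nat.exists_eq_add_of_le hlo
  obtain ⟨s, hs⟩ : ∃ s, t * (3 * y + 1) = 2 * n * (y + j) + s := by
    refine Nat.exists_eq_add_of_le ?_
    nlinarith
  have h3s : 3 * s = 2 * n + r := by
    have : 3 * t * (3 * y + 1) = (2 * n + k) * (3 * y + 1) := by rw [ht]
    nlinarith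
  have hmod : t * (3 * y + 1) % (2 * n) = s := by
    rw [hs, Nat.mul_add_mod, Nat.mod_eq_of_lt (by omega)]
  refine ⟨t, by omega, ?_⟩
  rw [hmod, Nat.mod_eq_of_lt (show t < 2 * n by omega)]
  omega

theorem thirds_ne {N p e : ℕ} (hp : p < N) (h₁ : N ≤ 3 * e) (h₂ : 3 * e ≤ 2 * N) :
    3 * p / N ≠ 3 * ((p + e) % N) / N := by
  have hN : 0 < N := by omega
  intro h
  have hp₁ := Nat.div_add_mod (3 * p) N
  have hp₂ := Nat.mod_lt (3 * p) hN
  have hq₁ := Nat.div_add_mod (3 * ((p + e) % N)) N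
  have hq₂ := Nat.mod_lt (3 * ((p + e) % N)) hN
  rw [← h] at hq₁
  rcases lt_or_ge (p + e) N with hlt | hge
  · rw [Nat.mod_eq_of_lt hlt] at *
    omega
  · have : (p + e) % N = p + e - N := by
      rw [Nat.mod_eq_sub_mod hge, Nat.mod_eq_of_lt (by omega)]
    omega

theorem val_eq_of_sub_eq {N : ℕ} [NeZero N] {u v : ZMod N} {d : ℕ} (h : u - v = (d : ZMod N)) :
    u.val = (v.val + d) % N := by
  rw [sub_eq_iff_eq_add'.1 h, ZMod.val_add, ZMod.val_natCast, Nat.add_mod_mod]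

theorem wordRepresentable_of_multiplier {n x : ℕ} (hn : 3 ≤ n) {t : ℕ} (ht : t % 2 = 1)
    (ht1 : 2 * n ≤ 3 * (t % (2 * n))) (ht2 : 3 * (t % (2 * n)) ≤ 2 * (2 * n))
    (htx1 : 2 * n ≤ 3 * (t * x % (2 * n))) (htx2 : 3 * (t * x % (2 * n)) ≤ 2 * (2 * n)) :
    WordRepresentable (SimpleGraph.circulantGraph
      {((1 : ℕ) : ZMod (2*n)), ((x : ℕ) : ZMod (2*n)), ((n : ℕ) : ZMod (2*n))}) := by
  have : NeZero (2 * n) := ⟨by omega⟩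
  have hN : 0 < 2 * n := by omega
  have hthird : ∀ u : ZMod (2 * n), 3 * (t * u.val % (2 * n)) / (2 * n) < 3 := fun u => by
    rw [Nat.div_lt_iff_lt_mul hN]
    have := Nat.mod_lt (t * u.val) hN
    omega
  have htn : t * n % (2 * n) = n := by
    obtain ⟨s, rfl⟩ : ∃ s, t = 2 * s + 1 := ⟨t / 2, by omega⟩
    rw [show (2 * s + 1) * n = 2 * n * s + n by ring, Nat.mul_add_mod,
      Nat.mod_eq_of_lt (by omega)]
  have step : ∀ (u v : ZMod (2 * n)) (d : ℕ), u - v = (d : ZMod (2 * n)) →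
      2 * n ≤ 3 * (t * d % (2 * n)) → 3 * (t * d % (2 * n)) ≤ 2 * (2 * n) →
      3 * (t * v.val % (2 * n)) / (2 * n) ≠ 3 * (t * u.val % (2 * n)) / (2 * n) := by
    intro u v d h h₁ h₂
    have := thirds_ne (Nat.mod_lt (t * v.val) hN) h₁ h₂
    rwa [← Nat.add_mod, ← Nat.mul_add, ← Nat.mul_mod_mod t (v.val + d), ← val_eq_of_sub_eq h]
      at this
  have jump : ∀ u v : ZMod (2 * n), u - v ∈ ({((1 : ℕ) : ZMod (2*n)), ((x : ℕ) : ZMod (2*n)),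
      ((n : ℕ) : ZMod (2*n))} : Set (ZMod (2 * n))) →
      3 * (t * v.val % (2 * n)) / (2 * n) ≠ 3 * (t * u.val % (2 * n)) / (2 * n) := by
    rintro u v (h | h | h)
    · exact step u v 1 h (by simpa using ht1) (by simpa using ht2)
    · exact step u v x h htx1 htx2
    · exact step u v n h (by omega) (by omega)
  refine wordRepresentable_of_fourColoring (fun u => 3 * (t * u.val % (2 * n)) / (2 * n))
    (fun u => (hthird u).trans (by omega)) ?_ ?_
  · intro u v h
    rcases (SimpleGraph.circulantGraph_adj _ u v).mp h with ⟨_, h | h⟩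
    · exact (jump u v h).symm
    · exact jump v u h
  · intro a b c d _ _ _ _ _ _ _ hd
    exact absurd (hthird d) (by omega)

/-- Adjacency in `C_{4x}(1, x, 2x)` in terms of the column `i / x` and the row `i % x`. -/
def GridAdj (x c r c' r' : ℕ) : Prop :=
  (r = r' ∧ c ≠ c') ∨ (c = c' ∧ (r' = r + 1 ∨ r = r' + 1)) ∨
    (r + 1 = x ∧ r' = 0 ∧ c' = (c + 1) % 4) ∨ (r' + 1 = x ∧ r = 0 ∧ c = (c' + 1) % 4)

theorem gridAdj_comm {x c r c' r' : ℕ} : GridAdj x c r c' r' ↔ GridAdj x c' r' c r := by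
  unfold GridAdj
  omega

/-- An edge along which the colour `c + 2 (r % 2)` increases by one modulo `4` either stays in
its row or crosses the seam, in a direction that depends only on the parity of `x`. -/
theorem row_eq_of_gridAdj {x c r c' r' : ℕ} (h : GridAdj x c r c' r')
    (hcol : (c' + 2 * (r' % 2)) % 4 = ((c + 2 * (r % 2)) % 4 + 1) % 4) :
    r = r' ∨ (x % 2 = 1 ∧ r + 1 = x ∧ r' = 0) ∨ (x % 2 = 0 ∧ r = 0 ∧ r' + 1 = x) := by
  unfold GridAdj at h
  omega

theorem gridAdj_add_mod {x i d : ℕ} (hx : 4 ≤ x) (hi : i < 4 * x)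
    (hd : d = 1 ∨ d = x ∨ d = 2 * x) :
    GridAdj x (i / x) (i % x) ((i + d) % (4 * x) / x) ((i + d) % (4 * x) % x) := by
  obtain ⟨c, r, hr, rfl⟩ : ∃ c r, r < x ∧ i = x * c + r :=
    ⟨i / x, i % x, Nat.mod_lt _ (by omega), (Nat.div_add_mod i x).symm⟩
  have hx0 : 0 < x := by omega
  have hc : c < 4 := by nlinarith
  have hdiv : ∀ c r, r < x → (x * c + r) / x = c := fun c r h => by
    rw [Nat.mul_add_div hx0, Nat.div_eq_of_lt h, add_zero]
  have hmod : ∀ c r, r < x → (x * c + r) % x = r := fun c r h => by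
    rw [Nat.mul_add_mod, Nat.mod_eq_of_lt h]
  have hred : ∀ c r, r < x → (x * c + r) % (4 * x) = x * (c % 4) + r := fun c r h => by
    rw [mul_comm 4 x, Nat.mod_mul, hdiv c r h, hmod c r h, add_comm]
  obtain ⟨c', r', hr', he, hg⟩ : ∃ c' r', r' < x ∧ x * c + r + d = x * c' + r' ∧
      GridAdj x c r (c' % 4) r' := by
    unfold GridAdj
    rcases hd with rfl | rfl | rfl
    · by_cases h : r + 1 = x
      · exact ⟨c + 1, 0, by omega, by rw [mul_add]; omega, by omega⟩
      · exact ⟨c, r + 1, by omega, by omega, by omega⟩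
    · exact ⟨c + 1, r, hr, by ring, by omega⟩
    · exact ⟨c + 2, r, hr, by ring, by omega⟩
  rw [he, hred c' r' hr', hdiv _ _ hr', hmod _ _ hr', hdiv _ _ hr, hmod _ _ hr]
  exact hg

theorem wordRepresentable_of_eq_two_mul {n x : ℕ} (hx : 4 ≤ x) (hnx : n = 2 * x) :
    WordRepresentable (SimpleGraph.circulantGraph
      {((1 : ℕ) : ZMod (2*n)), ((x : ℕ) : ZMod (2*n)), ((n : ℕ) : ZMod (2*n))}) := by
  have : NeZero (2 * n) := ⟨by omega⟩
  have hN : 2 * n = 4 * x := by omega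
  set G := SimpleGraph.circulantGraph
    {((1 : ℕ) : ZMod (2*n)), ((x : ℕ) : ZMod (2*n)), ((n : ℕ) : ZMod (2*n))} with hG
  have hval : ∀ u : ZMod (2 * n), u.val < 4 * x := fun u => hN ▸ u.val_lt
  have hcol : ∀ u : ZMod (2 * n), u.val / x < 4 := fun u => by
    rw [Nat.div_lt_iff_lt_mul (by omega)]
    exact hval u
  have hgrid : ∀ u v, G.Adj u v → GridAdj x (u.val / x) (u.val % x) (v.val / x) (v.val % x) := by
    have jump : ∀ u v : ZMod (2 * n), u - v ∈ ({((1 : ℕ) : ZMod (2*n)), ((x : ℕ) : ZMod (2*n)),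
        ((n : ℕ) : ZMod (2*n))} : Set (ZMod (2 * n))) →
        GridAdj x (v.val / x) (v.val % x) (u.val / x) (u.val % x) := by
      have step : ∀ (u v : ZMod (2 * n)) (d : ℕ), u - v = (d : ZMod (2 * n)) →
          d = 1 ∨ d = x ∨ d = 2 * x →
          GridAdj x (v.val / x) (v.val % x) (u.val / x) (u.val % x) := by
        intro u v d h hd
        have hu : u.val = (v.val + d) % (4 * x) := by
          simpa only [hN] using val_eq_of_sub_eq h
        rw [hu]
        exact gridAdj_add_mod hx (hval v) hd
      rintro u v (h | h | h)
      · exact step u v 1 h (by omega)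
      · exact step u v x h (by omega)
      · exact step u v n h (by omega)
    intro u v h
    rcases (SimpleGraph.circulantGraph_adj _ u v).mp h with ⟨_, h | h⟩
    · exact gridAdj_comm.1 (jump u v h)
    · exact jump v u h
  have hsame : ∀ u v : ZMod (2 * n), u.val % x = v.val % x → u ≠ v → G.Adj u v := by
    have hlt : ∀ u v : ZMod (2 * n), u.val % x = v.val % x → u.val < v.val → G.Adj u v := by
      intro u v hr hl
      have hu := Nat.div_add_mod u.val x
      have hv := Nat.div_add_mod v.val x
      have hcv := hcol v
      have hl' : u.val / x < v.val / x := by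
        by_contra hcon
        have := Nat.mul_le_mul_left x (not_lt.1 hcon)
        omega
      obtain ⟨k, hk⟩ := Nat.exists_eq_add_of_lt hl'
      have hvu : v.val = u.val + (k + 1) * x := by
        rw [← hv, ← hu, hk, hr]
        ring
      have hzero : ((4 * x : ℕ) : ZMod (2 * n)) = 0 := by
        rw [← hN, ZMod.natCast_self]
      have hcast : v = u + (((k + 1) * x : ℕ) : ZMod (2 * n)) := by
        rw [← ZMod.natCast_zmod_val v, hvu, Nat.cast_add, ZMod.natCast_zmod_val]
      rw [hG, SimpleGraph.circulantGraph_adj]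
      refine ⟨by rintro rfl; exact lt_irrefl _ hl, ?_⟩
      have hk3 : k < 3 := by linarith [Nat.zero_le (u.val / x)]
      interval_cases k
      · right
        rw [hcast]
        simp
      · right
        have : (n : ZMod (2 * n)) = (((1 + 1) * x : ℕ) : ZMod (2 * n)) := by
          congr 1
        rw [hcast, add_sub_cancel_left, ← this]
        simp
      · left
        rw [hcast]
        have : (x : ZMod (2 * n)) = -(((2 + 1) * x : ℕ) : ZMod (2 * n)) := by
          rw [eq_neg_iff_add_eq_zero, ← hzero]
          push_cast
          ring
        rw [sub_add_cancel_left, ← this]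
        simp
    intro u v hr hne
    rcases lt_or_gt_of_ne (fun h => hne (ZMod.val_injective _ h)) with h | h
    · exact hlt u v hr h
    · exact (hlt v u hr.symm h).symm
  refine wordRepresentable_of_fourColoring (fun u => (u.val / x + 2 * (u.val % x % 2)) % 4)
    (fun u => Nat.mod_lt _ (by omega)) ?_ ?_
  · intro u v h
    have h₁ := hcol u
    have h₂ := hcol v
    have h₃ := hgrid u v h
    unfold GridAdj at h₃
    generalize u.val / x = c at *
    generalize v.val / x = c' at *
    generalize u.val % x = r at *
    generalize v.val % x = r' at *
    omega
  · intro a b c d hab hbc hcd hda ha hb hc hd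
    have hrows : a.val % x = c.val % x ∧ b.val % x = d.val % x := by
      have h₁ := hgrid a b hab
      have h₂ := hgrid b c hbc
      have h₃ := hgrid c d hcd
      have h₄ := hgrid d a hda
      have h₁ := row_eq_of_gridAdj h₁ (by omega)
      have h₂ := row_eq_of_gridAdj h₂ (by omega)
      have h₃ := row_eq_of_gridAdj h₃ (by omega)
      have h₄ := row_eq_of_gridAdj h₄ (by omega)
      omega
    refine ⟨hsame a c hrows.1 ?_, hsame b d hrows.2 ?_⟩
    · rintro rfl
      omega
    · rintro rfl
      omega

theorem stmt19 (n x : ℕ) (hn : 3 ≤ n) (hx1 : 1 < x) (hxn : x < n)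
    (h0 : n % 3 = 2) (h1 : x % 3 = 1) (h2 : 3*x ≤ 2*n) :
    WordRepresentable (SimpleGraph.circulantGraph {((1 : ℕ) : ZMod (2*n)), ((x : ℕ) : ZMod (2*n)), ((n : ℕ) : ZMod (2*n))}) := by
  by_cases hnx : n = 2 * x
  · exact wordRepresentable_of_eq_two_mul (by omega) hnx
  · obtain ⟨t, ht, ht1, ht2, htx1, htx2⟩ := exists_odd_multiplier hx1 h0 h1 h2 hnx
    exact wordRepresentable_of_multiplier hn ht ht1 ht2 htx1 htx2
end
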